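/- arXiv:0810.0868 — 2 statements merged into one kernel-verified Lean document; each statement's English description precedes it below -/
import Mathlib

section
/- Let T ∈ BPT(n), rooted as described, and let v be an internal vertex with two internal children v₁ and v₂. Then for every s ≥ 1 and every k ≥ 1: R(v,s,k) = ∑_{s₁=0}^{s−1} (∑_{k₁ ≥ 0} R(v₁,s₁,k₁)) · R(v₂, s−1−s₁, k−1) · β(k)/β(k−1) + ∑_{s₂=0}^{s−1} (∑_{k₂ ≥ 0} R(v₂,s₂,k₂)) · R(v₁, s−1−s₂, k−1) · β(k)/β(k−1) + ∑_{s₁=0}^{s} ∑_{k₁=0}^{k−2} R(v₁,s₁,k₁) · R(v₂, s−s₁, k−2−k₁) · β(k)/(β(k₁)·β(k−2−k₁)), where an empty sum equals zero and β(k)/β(k−1) = 2k+1. -/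
open scoped Classical

noncomputable section

/-- `b n = (2n-5)!!`, the number of fully resolved phylogenetic trees on `n` leaves. -/
def numBPT (n : ℕ) : ℕ := ∏ k ∈ Finset.Icc 3 n, (2 * k - 5)

/-- `β m = b (m+3)`, the number of fully resolved phylogenetic trees with exactly `m`
internal edges. -/
def beta (m : ℕ) : ℕ := numBPT (m + 3)

/-- A rooted binary tree with leaves labelled by `α`: every internal vertex has exactly
two children.  This is the structure obtained from a fully resolved phylogenetic tree
`T ∈ BPT(n)` by deleting leaf `n` and rooting at the vertex `v₀` that was adjacent to
leaf `n`. -/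
inductive RTree (α : Type) : Type
  | leaf (a : α) : RTree α
  | node (l r : RTree α) : RTree α

namespace RTree

variable {α : Type}

/-- `t` is an internal vertex (not a leaf). -/
def isNode : RTree α → Prop
  | leaf _ => False
  | node _ _ => True

/-- The multiset of leaf labels of `t`. -/
def labels : RTree α → Multiset α
  | leaf a => {a}
  | node l r => labels l + labels r

/-- The subtree `T_v` consisting of a vertex `v` (addressed by the path `p` of
left/right choices from the root) and all of its descendants. -/
def subtreeAt : RTree α → List Bool → Option (RTree α)
  | t, [] => some t
  | leaf _, _ :: _ => none
  | node l r, b :: p => subtreeAt (if b then r else l) p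

/-- The set of vertices of `t`, addressed by paths from the root. -/
def positions : RTree α → Finset (List Bool)
  | leaf _ => {[]}
  | node l r =>
      insert [] (((positions l).image (List.cons false)) ∪ ((positions r).image (List.cons true)))

/-- `E̊(t)`: the internal edges of the rooted tree, i.e. the edges both of whose
endpoints are internal vertices.  An edge is addressed by the position of its lower
(child) endpoint, which must be a non-root internal vertex (its parent is automatically
internal). -/
def internalEdges (t : RTree α) : Finset (List Bool) :=
  (positions t).filter (fun p => p ≠ [] ∧ ∃ t', subtreeAt t p = some t' ∧ t'.isNode)

/-- One step of adjacency in the forest `t - E`: vertices `p` and `q` are joined by an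
edge of the tree (one is the parent of the other) that has not been cut (is not in `E`). -/
def stepRel (E : Finset (List Bool)) (p q : List Bool) : Prop :=
  (q = p.dropLast ∧ p ≠ [] ∧ p ∉ E) ∨ (p = q.dropLast ∧ q ≠ [] ∧ q ∉ E)

/-- The connected component of the forest `t - E` containing the vertex `p`. -/
def component (t : RTree α) (E : Finset (List Bool)) (p : List Bool) : Finset (List Bool) :=
  (positions t).filter (fun q => Relation.ReflTransGen (stepRel E) p q)

/-- The set of connected components `F₁, …, F_{|E|+1}` of the forest `t - E`. -/
def components (t : RTree α) (E : Finset (List Bool)) : Finset (Finset (List Bool)) :=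
  (positions t).image (component t E)

/-- `|E̊(F)|`: the number of internal edges of the tree contained in (i.e. with both
endpoints in) the component `C` of the forest `t - E`. -/
def compEdgeCount (t : RTree α) (E : Finset (List Bool)) (C : Finset (List Bool)) : ℕ :=
  ((internalEdges t).filter (fun p => p ∉ E ∧ p ∈ C)).card

/-- `N_E(T_v) = ∏ᵢ β(|E̊(Fᵢ)|)`, the product over the components of `T_v - E`. -/
def NEdges (t : RTree α) (E : Finset (List Bool)) : ℕ :=
  ∏ C ∈ components t E, beta (compEdgeCount t E C)

/-- `κ(v,E)`: the number of internal edges in the component of `T_v - E` containing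
the root `v` of `T_v`. -/
def kappa (t : RTree α) (E : Finset (List Bool)) : ℕ :=
  compEdgeCount t E (component t E [])

/-- `R(v,s,k) = ∑_{E ⊆ E̊(T_v), |E| = s, κ(v,E) = k} N_E(T_v)`. -/
def R (t : RTree α) (s k : ℕ) : ℕ :=
  ∑ E ∈ (internalEdges t).powerset.filter (fun E => E.card = s ∧ kappa t E = k),
    NEdges t E

end RTree

end

open RTree

namespace RAux

variable {α : Type}

noncomputable def topv : (List Bool → Prop) → List Bool → List Bool
  | _, [] => []
  | E, b :: p =>
    if topv (fun q => E (b :: q)) p ≠ [] then b :: topv (fun q => E (b :: q)) p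
    else if E [b] then [b] else []

lemma topv_congr (p : List Bool) : ∀ (E E' : List Bool → Prop),
    (∀ q, q ≠ [] → (E q ↔ E' q)) → topv E p = topv E' p := by
  induction p with
  | nil => intros; rfl
  | cons b p ih =>
    intro E E' h
    have h1 := ih (fun q => E (b :: q)) (fun q => E' (b :: q)) (fun q _ => h _ (by simp))
    have h2 := h [b] (by simp)
    simp only [topv, h1, h2]

lemma topv_step (p : List Bool) : ∀ (E : List Bool → Prop), p ≠ [] → ¬ E p →
    topv E p = topv E p.dropLast := by
  induction p with
  | nil => intro E h; simp at h
  | cons b p ih =>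
    intro E _ hE
    cases p with
    | nil => simp [topv, hE]
    | cons c p =>
      have := ih (fun q => E (b :: q)) (by simp) hE
      rw [List.dropLast_cons_of_ne_nil (by simp)]
      rw [topv, this, ← topv]

lemma topv_self (p : List Bool) : ∀ (E : List Bool → Prop), E p → topv E p = p := by
  induction p with
  | nil => intro E h; rfl
  | cons b p ih =>
    intro E hE
    have := ih (fun q => E (b :: q)) hE
    rw [topv, this]
    cases p with
    | nil => simp [hE]
    | cons c p => simp

lemma topv_mem (p : List Bool) : ∀ (E : List Bool → Prop), topv E p = [] ∨ E (topv E p) := by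
  induction p with
  | nil => intro E; left; rfl
  | cons b p ih =>
    intro E
    have := ih (fun q => E (b :: q))
    rw [topv]
    split_ifs with h1 h2
    · right; exact this.resolve_left h1
    · right; exact h2
    · left; rfl

lemma stepRel_symm (E : Finset (List Bool)) {p q : List Bool} (h : stepRel E p q) :
    stepRel E q p := by
  unfold stepRel at *; tauto

lemma reach_symm (E : Finset (List Bool)) {p q : List Bool}
    (h : Relation.ReflTransGen (stepRel E) p q) : Relation.ReflTransGen (stepRel E) q p := by
  induction h with
  | refl => exact .refl
  | tail _ h ih => exact .head (stepRel_symm E h) ih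

lemma reach_top (E : Finset (List Bool)) (p : List Bool) :
    Relation.ReflTransGen (stepRel E) p (topv (· ∈ E) p) := by
  induction p using List.reverseRecOn with
  | nil => exact .refl
  | append_singleton q x ih =>
    by_cases h : q ++ [x] ∈ E
    · rw [topv_self _ _ h]
    · rw [topv_step _ _ (by simp) h, List.dropLast_concat]
      refine .head (Or.inl ⟨by simp, by simp, h⟩) ih

lemma reach_iff (E : Finset (List Bool)) (p q : List Bool) :
    Relation.ReflTransGen (stepRel E) p q ↔ topv (· ∈ E) p = topv (· ∈ E) q := by
  constructor
  · intro h
    induction h with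
    | refl => rfl
    | tail _ h ih =>
      rw [ih]
      rcases h with ⟨rfl, h1, h2⟩ | ⟨rfl, h1, h2⟩
      · exact topv_step _ _ h1 h2
      · exact (topv_step _ _ h1 h2).symm
  · intro h
    have h1 := reach_top E p
    rw [h] at h1
    exact h1.trans (reach_symm E (reach_top E q))

noncomputable def cnt (t : RTree α) (E : Finset (List Bool)) (r : List Bool) : ℕ :=
  ((internalEdges t).filter (fun p => p ∉ E ∧ topv (· ∈ E) p = r)).card

noncomputable def M (t : RTree α) (E : Finset (List Bool)) : ℕ :=
  ∏ r ∈ E, beta (cnt t E r)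

lemma nil_mem (t : RTree α) : [] ∈ positions t := by
  cases t <;> simp [positions]

lemma ie_sub (t : RTree α) : internalEdges t ⊆ positions t := Finset.filter_subset _ _

lemma nil_not_mem (t : RTree α) : [] ∉ internalEdges t := by simp [internalEdges]

lemma ced (t : RTree α) (E : Finset (List Bool)) (r : List Bool) :
    compEdgeCount t E ((positions t).filter (fun q => r = topv (· ∈ E) q)) = cnt t E r := by
  unfold compEdgeCount cnt
  congr 1
  apply Finset.filter_congr
  intro p hp
  have := ie_sub t hp
  simp [this, eq_comm]

lemma kappa_eq (t : RTree α) (E : Finset (List Bool)) : kappa t E = cnt t E [] := by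
  rw [← ced]
  simp only [kappa, component, reach_iff]
  rfl

lemma NEdges_eq (t : RTree α) (E : Finset (List Bool)) (hE : E ⊆ internalEdges t) :
    NEdges t E = beta (kappa t E) * M t E := by
  have hn : [] ∉ E := fun h => nil_not_mem t (hE h)
  have hc : components t E =
      (insert [] E).image (fun r => (positions t).filter (fun q => r = topv (· ∈ E) q)) := by
    ext C
    simp only [components, component, reach_iff, Finset.mem_image]
    constructor
    · rintro ⟨p, hp, rfl⟩
      refine ⟨topv (· ∈ E) p, ?_, rfl⟩
      have := topv_mem p (· ∈ E)
      simpa using this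
    · rintro ⟨r, hr, rfl⟩
      rcases Finset.mem_insert.1 hr with rfl | h
      · exact ⟨[], nil_mem t, rfl⟩
      · refine ⟨r, ie_sub t (hE h), ?_⟩
        rw [topv_self r (· ∈ E) h]
  have ht : ∀ r ∈ insert [] E, r ∈ positions t ∧ topv (· ∈ E) r = r := by
    intro r hr
    rcases Finset.mem_insert.1 hr with rfl | h
    · exact ⟨nil_mem t, rfl⟩
    · exact ⟨ie_sub t (hE h), topv_self r (· ∈ E) h⟩
  rw [NEdges, hc, Finset.prod_image, Finset.prod_insert hn]
  · simp only [ced, kappa_eq, M]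
  · intro r hr r' hr' h
    simp only at h
    have h1 := ht r hr
    have : r ∈ (positions t).filter (fun q => r = topv (· ∈ E) q) := by
      simp [h1.1, h1.2]
    rw [h] at this
    have := (Finset.mem_filter.1 this).2
    rw [h1.2] at this
    exact this.symm

/-- combined cut set -/
noncomputable def un (A B : Finset (List Bool)) : Finset (List Bool) :=
  A.image (List.cons false) ∪ B.image (List.cons true)

lemma ie_node (l r : RTree α) (h₁ : l.isNode) (h₂ : r.isNode) :
    internalEdges (node l r) =
      insert [false] (insert [true] (un (internalEdges l) (internalEdges r))) := by
  have a1 := nil_mem l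
  have a2 := nil_mem r
  ext p
  rcases p with _ | ⟨b, _ | ⟨c, p⟩⟩
  · simp [internalEdges, un]
  · cases b <;> simp [internalEdges, un, positions, subtreeAt, *]
  · cases b <;> simp [internalEdges, un, positions, subtreeAt]

noncomputable def comb (c₁ c₂ : Bool) (A B : Finset (List Bool)) : Finset (List Bool) :=
  (if c₁ then {[false]} else ∅) ∪ ((if c₂ then {[true]} else ∅) ∪ un A B)

lemma sum_comb (l r : RTree α) (h₁ : l.isNode) (h₂ : r.isNode)
    (g : Finset (List Bool) → ℚ) :
    ∑ E ∈ (internalEdges (node l r)).powerset, g E =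
      ∑ A ∈ (internalEdges l).powerset, ∑ B ∈ (internalEdges r).powerset,
        (g (comb false false A B) + g (comb false true A B) +
          (g (comb true false A B) + g (comb true true A B))) := by
  have key : ∀ g : Finset (List Bool) → ℚ,
      ∑ E ∈ (un (internalEdges l) (internalEdges r)).powerset, g E =
      ∑ A ∈ (internalEdges l).powerset, ∑ B ∈ (internalEdges r).powerset, g (un A B) := by
    intro g
    rw [← Finset.sum_product']
    symm
    refine Finset.sum_bij' (fun x _ => un x.1 x.2)
      (fun E _ => ((internalEdges l).filter (fun p => false :: p ∈ E),
        (internalEdges r).filter (fun p => true :: p ∈ E))) ?_ ?_ ?_ ?_ ?_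
    · rintro ⟨A, B⟩ h
      simp only [Finset.mem_product, Finset.mem_powerset] at h ⊢
      exact Finset.union_subset_union (Finset.image_subset_image h.1)
        (Finset.image_subset_image h.2)
    · intro E _
      simp
    · rintro ⟨A, B⟩ h
      simp only [Finset.mem_product, Finset.mem_powerset] at h
      ext p
      · have := @h.1 p
        simpa [un] using this
      · have := @h.2 p
        simpa [un] using this
    · intro E hE
      rw [Finset.mem_powerset] at hE
      ext p
      have := @hE p
      rcases p with _ | ⟨b, p⟩
      · simp [un] at this ⊢
        exact this
      · cases b <;> simp [un] at this ⊢ <;> exact this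
    · intros; rfl
  have n2 : [true] ∉ un (internalEdges l) (internalEdges r) := by
    simp [un, nil_not_mem]
  have n1 : [false] ∉ insert [true] (un (internalEdges l) (internalEdges r)) := by
    simp [un, nil_not_mem]
  rw [ie_node l r h₁ h₂, Finset.sum_powerset_insert n1, Finset.sum_powerset_insert n2,
    Finset.sum_powerset_insert n2, key, key, key, key]
  simp only [← Finset.sum_add_distrib, comb]
  simp [Finset.insert_comm [true] [false]]

section comb
variable (c₁ c₂ : Bool) (A B : Finset (List Bool))

lemma mem_comb_false (hA : [] ∉ A) (q : List Bool) :
    false :: q ∈ comb c₁ c₂ A B ↔ (q = [] ∧ c₁) ∨ q ∈ A := by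
  cases c₁ <;> cases c₂ <;> simp [comb, un]

lemma mem_comb_true (hB : [] ∉ B) (q : List Bool) :
    true :: q ∈ comb c₁ c₂ A B ↔ (q = [] ∧ c₂) ∨ q ∈ B := by
  cases c₁ <;> cases c₂ <;> simp [comb, un]

lemma topv_false (hA : [] ∉ A) (q : List Bool) :
    topv (· ∈ comb c₁ c₂ A B) (false :: q) =
      if topv (· ∈ A) q ≠ [] then false :: topv (· ∈ A) q else if c₁ then [false] else [] := by
  rw [topv, topv_congr q _ (· ∈ A)]
  · simp [mem_comb_false, hA]
  · intro q hq; simp [mem_comb_false, hA, hq]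

lemma topv_true (hB : [] ∉ B) (q : List Bool) :
    topv (· ∈ comb c₁ c₂ A B) (true :: q) =
      if topv (· ∈ B) q ≠ [] then true :: topv (· ∈ B) q else if c₂ then [true] else [] := by
  rw [topv, topv_congr q _ (· ∈ B)]
  · simp [mem_comb_true, hB]
  · intro q hq; simp [mem_comb_true, hB, hq]

lemma card_un : (un A B).card = A.card + B.card := by
  rw [un, Finset.card_union_of_disjoint, Finset.card_image_of_injective,
    Finset.card_image_of_injective]
  · exact List.cons_injective
  · exact List.cons_injective
  · rw [Finset.disjoint_left]; simp

lemma card_comb (hA : [] ∉ A) (hB : [] ∉ B) :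
    (comb c₁ c₂ A B).card = A.card + B.card + c₁.toNat + c₂.toNat := by
  have h1 : [false] ∉ un A B := by simp [un, hA]
  have h2 : [true] ∉ un A B := by simp [un, hB]
  have := card_un A B
  cases c₁ <;> cases c₂ <;> simp [comb, ← Finset.insert_eq, h1, h2, this]

lemma prod_comb (hA : [] ∉ A) (hB : [] ∉ B) (g : List Bool → ℕ) :
    ∏ x ∈ comb c₁ c₂ A B, g x =
      (if c₁ then g [false] else 1) * ((if c₂ then g [true] else 1) *
        ((∏ a ∈ A, g (false :: a)) * ∏ b ∈ B, g (true :: b))) := by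
  have h1 : [false] ∉ un A B := by simp [un, hA]
  have h2 : [true] ∉ un A B := by simp [un, hB]
  have : ∏ x ∈ un A B, g x = (∏ a ∈ A, g (false :: a)) * ∏ b ∈ B, g (true :: b) := by
    rw [un, Finset.prod_union, Finset.prod_image, Finset.prod_image]
    · intro a _ b _ h; simpa using h
    · intro a _ b _ h; simpa using h
    · rw [Finset.disjoint_left]; simp
  cases c₁ <;> cases c₂ <;> simp [comb, ← Finset.insert_eq, h1, h2, this, mul_left_comm]

lemma cnt_sum (t : RTree α) (E : Finset (List Bool)) (x : List Bool) :
    cnt t E x = ∑ p ∈ internalEdges t, if p ∉ E ∧ topv (· ∈ E) p = x then 1 else 0 := by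
  rw [cnt, Finset.card_filter]

lemma cnt_node (l r : RTree α) (h₁ : l.isNode) (h₂ : r.isNode) (E : Finset (List Bool))
    (x : List Bool) :
    cnt (node l r) E x =
      (if [false] ∉ E ∧ topv (· ∈ E) [false] = x then 1 else 0) +
      ((if [true] ∉ E ∧ topv (· ∈ E) [true] = x then 1 else 0) +
      ((∑ p ∈ internalEdges l,
          if false :: p ∉ E ∧ topv (· ∈ E) (false :: p) = x then 1 else 0) +
       (∑ p ∈ internalEdges r,
          if true :: p ∉ E ∧ topv (· ∈ E) (true :: p) = x then 1 else 0))) := by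
  have n2 : [true] ∉ un (internalEdges l) (internalEdges r) := by
    simp [un, nil_not_mem]
  have n1 : [false] ∉ insert [true] (un (internalEdges l) (internalEdges r)) := by
    simp [un, nil_not_mem]
  rw [cnt_sum, ie_node l r h₁ h₂, Finset.sum_insert n1, Finset.sum_insert n2, un,
    Finset.sum_union, Finset.sum_image, Finset.sum_image]
  · intro a _ b _ h; simpa using h
  · intro a _ b _ h; simpa using h
  · rw [Finset.disjoint_left]; simp

variable (l r : RTree α) (h₁ : l.isNode) (h₂ : r.isNode)
  (hA : A ⊆ internalEdges l) (hB : B ⊆ internalEdges r)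

lemma cnt_comb (x : List Bool) (h₁ : l.isNode) (h₂ : r.isNode)
    (hA : A ⊆ internalEdges l) (hB : B ⊆ internalEdges r) :
    cnt (node l r) (comb c₁ c₂ A B) x =
      match x with
      | [] => (if c₁ then 0 else 1 + cnt l A []) + (if c₂ then 0 else 1 + cnt r B [])
      | [false] => if c₁ then cnt l A [] else 0
      | [true] => if c₂ then cnt r B [] else 0
      | false :: a => cnt l A a
      | true :: a => cnt r B a := by
  have nA : [] ∉ A := fun h => nil_not_mem l (hA h)
  have nB : [] ∉ B := fun h => nil_not_mem r (hB h)
  have e1 : ∀ (x : List Bool), (∑ p ∈ internalEdges l,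
      if false :: p ∉ comb c₁ c₂ A B ∧ topv (· ∈ comb c₁ c₂ A B) (false :: p) = x then 1 else 0)
      = ∑ p ∈ internalEdges l, if p ∉ A ∧ (if topv (· ∈ A) p ≠ [] then false :: topv (· ∈ A) p
        else if c₁ then [false] else []) = x then 1 else 0 := by
    intro x
    apply Finset.sum_congr rfl
    intro p hp
    have : p ≠ [] := fun h => nil_not_mem l (h ▸ hp)
    rw [topv_false _ _ _ _ nA]
    simp only [mem_comb_false _ _ _ _ nA, this, false_and, false_or]
  have e2 : ∀ (x : List Bool), (∑ p ∈ internalEdges r,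
      if true :: p ∉ comb c₁ c₂ A B ∧ topv (· ∈ comb c₁ c₂ A B) (true :: p) = x then 1 else 0)
      = ∑ p ∈ internalEdges r, if p ∉ B ∧ (if topv (· ∈ B) p ≠ [] then true :: topv (· ∈ B) p
        else if c₂ then [true] else []) = x then 1 else 0 := by
    intro x
    apply Finset.sum_congr rfl
    intro p hp
    have : p ≠ [] := fun h => nil_not_mem r (h ▸ hp)
    rw [topv_true _ _ _ _ nB]
    simp only [mem_comb_true _ _ _ _ nB, this, false_and, false_or]
  rw [cnt_node l r h₁ h₂, e1, e2, topv_false _ _ _ _ nA, topv_true _ _ _ _ nB]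
  simp only [cnt_sum, mem_comb_false _ _ _ _ nA, mem_comb_true _ _ _ _ nB]
  have z1 : ∀ (t : RTree α) (D : Finset (List Bool)) (f : List Bool → List Bool)
      (y y' : List Bool), (∀ p, f p = y ↔ topv (· ∈ D) p = y') →
      (∑ p ∈ internalEdges t, if p ∉ D ∧ f p = y then 1 else 0) =
      ∑ p ∈ internalEdges t, if p ∉ D ∧ topv (· ∈ D) p = y' then 1 else 0 := by
    intro t D f y y' h
    simp only [h]
  have z0 : ∀ (t : RTree α) (D : Finset (List Bool)) (f : List Bool → List Bool)
      (y : List Bool), (∀ p, f p ≠ y) →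
      (∑ p ∈ internalEdges t, if p ∉ D ∧ f p = y then 1 else 0) = 0 := by
    intro t D f y h
    simp [h]
  have ite1 : ∀ (D : Finset (List Bool)) (b c : Bool) (y : List Bool) (p : List Bool),
      (if topv (· ∈ D) p ≠ [] then b :: topv (· ∈ D) p else if c then [b] else []) = y ↔
      match y with
      | [] => c = false ∧ topv (· ∈ D) p = []
      | [b'] => b' = b ∧ c = true ∧ topv (· ∈ D) p = []
      | b' :: a => b' = b ∧ topv (· ∈ D) p = a := by
    intro D b c y p
    generalize topv (· ∈ D) p = z
    rcases y with _ | ⟨b', _ | ⟨d, a⟩⟩ <;> cases z <;> cases c <;> simp <;> tauto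
  simp only [ite1]
  rcases x with _ | ⟨b, _ | ⟨d, a⟩⟩
  · cases c₁ <;> cases c₂ <;> simp [nA, nB, topv] <;> ring
  · cases b <;> cases c₁ <;> cases c₂ <;> simp [nA, nB, topv]
  · cases b <;> cases c₁ <;> cases c₂ <;> simp [nA, nB, topv]

lemma kappa_comb (h₁ : l.isNode) (h₂ : r.isNode)
    (hA : A ⊆ internalEdges l) (hB : B ⊆ internalEdges r) :
    kappa (node l r) (comb c₁ c₂ A B) =
      (if c₁ then 0 else 1 + kappa l A) + (if c₂ then 0 else 1 + kappa r B) := by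
  simp only [kappa_eq]
  rw [cnt_comb _ _ _ _ _ _ _ h₁ h₂ hA hB]

lemma M_comb (h₁ : l.isNode) (h₂ : r.isNode)
    (hA : A ⊆ internalEdges l) (hB : B ⊆ internalEdges r) :
    M (node l r) (comb c₁ c₂ A B) =
      (if c₁ then beta (kappa l A) else 1) * ((if c₂ then beta (kappa r B) else 1) *
        (M l A * M r B)) := by
  have nA : [] ∉ A := fun h => nil_not_mem l (hA h)
  have nB : [] ∉ B := fun h => nil_not_mem r (hB h)
  have eA : ∏ a ∈ A, beta (cnt (node l r) (comb c₁ c₂ A B) (false :: a)) = M l A := by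
    apply Finset.prod_congr rfl
    intro a ha
    rw [cnt_comb _ _ _ _ _ _ _ h₁ h₂ hA hB]
    cases a with
    | nil => exact absurd ha nA
    | cons => rfl
  have eB : ∏ a ∈ B, beta (cnt (node l r) (comb c₁ c₂ A B) (true :: a)) = M r B := by
    apply Finset.prod_congr rfl
    intro a ha
    rw [cnt_comb _ _ _ _ _ _ _ h₁ h₂ hA hB]
    cases a with
    | nil => exact absurd ha nB
    | cons => rfl
  rw [M, prod_comb _ _ _ _ nA nB, eA, eB]
  rw [cnt_comb _ _ _ _ _ _ _ h₁ h₂ hA hB, cnt_comb _ _ _ _ _ _ _ h₁ h₂ hA hB]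
  simp only [kappa_eq]
  cases c₁ <;> cases c₂ <;> simp

end comb

lemma beta_ne (m : ℕ) : (beta m : ℚ) ≠ 0 := by
  have : beta m ≠ 0 := by
    unfold beta numBPT
    rw [Finset.prod_ne_zero_iff]
    intro a ha
    have := (Finset.mem_Icc.1 ha).1
    omega
  exact_mod_cast this

noncomputable def Q (t : RTree α) (s k : ℕ) : ℚ :=
  ∑ E ∈ (internalEdges t).powerset, if E.card = s ∧ kappa t E = k then (M t E : ℚ) else 0

lemma R_eq (t : RTree α) (s k : ℕ) : (R t s k : ℚ) = beta k * Q t s k := by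
  rw [R, Q, Finset.sum_filter, Finset.mul_sum, Nat.cast_sum]
  apply Finset.sum_congr rfl
  intro E hE
  split_ifs with h
  · rw [NEdges_eq t E (Finset.mem_powerset.1 hE), h.2]; push_cast; ring
  · simp

lemma kappa_le (t : RTree α) (E : Finset (List Bool)) : kappa t E ≤ (internalEdges t).card :=
  Finset.card_filter_le _ _

lemma sum_R (t : RTree α) (s : ℕ) :
    ∑ k ∈ Finset.range ((internalEdges t).card + 1), (R t s k : ℚ) =
      ∑ E ∈ (internalEdges t).powerset,
        if E.card = s then (beta (kappa t E) * M t E : ℚ) else 0 := by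
  simp only [R_eq, Q, Finset.mul_sum]
  rw [Finset.sum_comm]
  apply Finset.sum_congr rfl
  intro E _
  have := kappa_le t E
  rw [Finset.sum_eq_single (kappa t E)]
  · simp
  · intro b _ hb; simp [hb.symm]
  · intro h; simp at h; omega

lemma alg1 {ι κ : Type*} (X : Finset ι) (Y : Finset κ) (a : ι → ℕ) (b c : κ → ℕ)
    (F : ι → ℚ) (G : κ → ℚ) (s k : ℕ) (hs : 1 ≤ s) (hk : 1 ≤ k) :
    ∑ s₁ ∈ Finset.range s, (∑ A ∈ X, if a A = s₁ then F A else 0) *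
      (∑ B ∈ Y, if b B = s - 1 - s₁ ∧ c B = k - 1 then G B else 0) =
    ∑ A ∈ X, ∑ B ∈ Y, if a A + b B + 1 = s ∧ c B + 1 = k then F A * G B else 0 := by
  simp only [Finset.sum_mul_sum]
  rw [Finset.sum_comm]
  apply Finset.sum_congr rfl; intro A _
  rw [Finset.sum_comm]
  apply Finset.sum_congr rfl; intro B _
  by_cases h : a A + b B + 1 = s ∧ c B + 1 = k
  · have h2 : b B = s - 1 - a A ∧ c B = k - 1 := by omega
    rw [Finset.sum_eq_single (a A), if_pos rfl, if_pos h2, if_pos h]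
    · intro x _ hx; simp [hx.symm]
    · intro h3; simp at h3; omega
  · rw [if_neg h]
    apply Finset.sum_eq_zero
    intro x hx
    rw [Finset.mem_range] at hx
    split_ifs
    · omega
    all_goals simp

lemma alg2 {ι κ : Type*} (X : Finset ι) (Y : Finset κ) (a d : ι → ℕ) (b c : κ → ℕ)
    (F : ι → ℚ) (G : κ → ℚ) (s k : ℕ) :
    ∑ s₁ ∈ Finset.range (s + 1), ∑ k₁ ∈ Finset.range (k - 1),
      (∑ A ∈ X, if a A = s₁ ∧ d A = k₁ then F A else 0) *
      (∑ B ∈ Y, if b B = s - s₁ ∧ c B = k - 2 - k₁ then G B else 0) =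
    ∑ A ∈ X, ∑ B ∈ Y, if a A + b B = s ∧ d A + c B + 2 = k then F A * G B else 0 := by
  simp only [Finset.sum_mul_sum]
  rw [← Finset.sum_product', Finset.sum_comm]
  apply Finset.sum_congr rfl; intro A _
  rw [Finset.sum_comm]
  apply Finset.sum_congr rfl; intro B _
  by_cases h : a A + b B = s ∧ d A + c B + 2 = k
  · have h2 : b B = s - a A ∧ c B = k - 2 - d A := by omega
    rw [Finset.sum_eq_single (a A, d A), if_pos ⟨rfl, rfl⟩, if_pos h2, if_pos h]
    · rintro ⟨x, y⟩ _ hx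
      rw [if_neg, zero_mul]
      rintro ⟨rfl, rfl⟩
      exact hx rfl
    · intro h3; simp at h3; omega
  · rw [if_neg h]
    apply Finset.sum_eq_zero
    rintro ⟨x, y⟩ hx
    simp only [Finset.mem_product, Finset.mem_range] at hx
    dsimp only
    split_ifs
    · omega
    all_goals simp

lemma Q_node (l r : RTree α) (h₁ : l.isNode) (h₂ : r.isNode) (s k : ℕ)
    (hs : 1 ≤ s) (hk : 1 ≤ k) :
    Q (node l r) s k =
      (∑ s₁ ∈ Finset.range s,
        (∑ k₁ ∈ Finset.range ((internalEdges l).card + 1), (R l s₁ k₁ : ℚ)) *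
          Q r (s - 1 - s₁) (k - 1)) +
      (∑ s₁ ∈ Finset.range s,
        (∑ k₁ ∈ Finset.range ((internalEdges r).card + 1), (R r s₁ k₁ : ℚ)) *
          Q l (s - 1 - s₁) (k - 1)) +
      ∑ s₁ ∈ Finset.range (s + 1), ∑ k₁ ∈ Finset.range (k - 1),
        Q l s₁ k₁ * Q r (s - s₁) (k - 2 - k₁) := by
  simp only [sum_R]
  unfold Q
  rw [alg1 _ _ _ _ _ _ _ s k hs hk, alg1 _ _ _ _ _ _ _ s k hs hk, alg2,
    sum_comb l r h₁ h₂]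
  rw [Finset.sum_comm (s := (internalEdges r).powerset)]
  simp only [← Finset.sum_add_distrib]
  apply Finset.sum_congr rfl; intro A hA
  apply Finset.sum_congr rfl; intro B hB
  rw [Finset.mem_powerset] at hA hB
  have nA : [] ∉ A := fun h => nil_not_mem l (hA h)
  have nB : [] ∉ B := fun h => nil_not_mem r (hB h)
  simp only [card_comb _ _ _ _ nA nB, kappa_comb _ _ _ _ _ _ h₁ h₂ hA hB,
    M_comb _ _ _ _ _ _ h₁ h₂ hA hB]
  have c0 : ¬ (0 = k) := by omega
  have c1 : ∀ x, 1 + x = k ↔ x + 1 = k := by intros; omega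
  have c2 : ∀ x y, 1 + x + (1 + y) = k ↔ x + y + 2 = k := by intros; omega
  simp [c0, c1, c2, add_comm B.card A.card]
  simp only [mul_assoc, mul_left_comm, mul_comm]
  ring

end RAux

/-- Let `T ∈ BPT(n)`, rooted as described, and let `v` be an internal
vertex with two internal children `v₁` and `v₂`.  Then for every `s ≥ 1` and `k ≥ 1`:
`R(v,s,k) = ∑_{s₁=0}^{s-1} (∑_{k₁≥0} R(v₁,s₁,k₁)) R(v₂,s-1-s₁,k-1) β(k)/β(k-1)`
`        + ∑_{s₂=0}^{s-1} (∑_{k₂≥0} R(v₂,s₂,k₂)) R(v₁,s-1-s₂,k-1) β(k)/β(k-1)`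
`        + ∑_{s₁=0}^{s} ∑_{k₁=0}^{k-2} R(v₁,s₁,k₁) R(v₂,s-s₁,k-2-k₁) β(k)/(β(k₁)β(k-2-k₁))`,
where an empty sum equals zero (the identity is stated in `ℚ`; note
`β(k)/β(k-1) = 2k+1`). -/
theorem R_rec_two_internal_children_pos (n : ℕ) (hn : 3 ≤ n) (t : RTree (Fin (n - 1)))
    (hnodup : t.labels.Nodup) (hcard : Multiset.card t.labels = n - 1)
    (p : List Bool) (tv v₁ v₂ : RTree (Fin (n - 1)))
    (hp : t.subtreeAt p = some tv) (htv : tv = RTree.node v₁ v₂)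
    (h₁ : v₁.isNode) (h₂ : v₂.isNode)
    (s : ℕ) (hs : 1 ≤ s) (k : ℕ) (hk : 1 ≤ k) :
    (R tv s k : ℚ) =
      (∑ s₁ ∈ Finset.range s,
        (∑ k₁ ∈ Finset.range ((internalEdges v₁).card + 1), (R v₁ s₁ k₁ : ℚ)) *
          (R v₂ (s - 1 - s₁) (k - 1) : ℚ) * ((beta k : ℚ) / (beta (k - 1) : ℚ))) +
      (∑ s₂ ∈ Finset.range s,
        (∑ k₂ ∈ Finset.range ((internalEdges v₂).card + 1), (R v₂ s₂ k₂ : ℚ)) *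
          (R v₁ (s - 1 - s₂) (k - 1) : ℚ) * ((beta k : ℚ) / (beta (k - 1) : ℚ))) +
      (∑ s₁ ∈ Finset.range (s + 1), ∑ k₁ ∈ Finset.range (k - 1),
        (R v₁ s₁ k₁ : ℚ) * (R v₂ (s - s₁) (k - 2 - k₁) : ℚ) *
          ((beta k : ℚ) / ((beta k₁ : ℚ) * (beta (k - 2 - k₁) : ℚ)))) := by
  subst htv
  rw [RAux.R_eq, RAux.Q_node v₁ v₂ h₁ h₂ s k hs hk, mul_add, mul_add]
  simp only [Finset.mul_sum]
  congr 1
  · congr 1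
    · apply Finset.sum_congr rfl
      intro x _
      rw [RAux.R_eq v₂ _ (k - 1)]
      have := RAux.beta_ne (k - 1)
      field_simp
    · apply Finset.sum_congr rfl
      intro x _
      rw [RAux.R_eq v₁ _ (k - 1)]
      have := RAux.beta_ne (k - 1)
      field_simp
  · apply Finset.sum_congr rfl
    intro x _
    apply Finset.sum_congr rfl
    intro y _
    rw [RAux.R_eq v₁, RAux.R_eq v₂]
    have := RAux.beta_ne y
    have := RAux.beta_ne (k - 2 - y)
    field_simp
end

section
/- Let n ≥ 3, T ∈ BPT(n), and 0 ≤ m ≤ n−3. Then q_m(T) = ∑_{s=m}^{n−3} (−1)^{s−m} · C(s,m) · r_s(T), where C(s,m) is the binomial coefficient. -/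
open scoped Classical symmDiff

noncomputable section

/-- `G`, together with the leaf-labelling `leaf`, is a fully resolved (binary)
phylogenetic tree on the leaf set `{1,…,n}`: a tree whose degree-one vertices are
exactly the (injectively) labelled leaves, all other vertices having degree three. -/
def IsBinaryPhylo {V : Type} [Fintype V] (n : ℕ) (G : SimpleGraph V) (leaf : Fin n → V) : Prop :=
  G.IsTree ∧ Function.Injective leaf ∧
    (∀ i, G.degree (leaf i) = 1) ∧
    ∀ v : V, v ∉ Set.range leaf → G.degree v = 3

/-- The split (bipartition of the leaf-label set, as an unordered pair of subsets of
`Fin n`) induced by the edge `e`: each side consists of the labels of the leaves lying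
in the corresponding component of `G` with `e` deleted. -/
def splitOfEdge {V : Type} [Fintype V] (n : ℕ) (G : SimpleGraph V) (leaf : Fin n → V)
    (e : Sym2 V) : Sym2 (Finset (Fin n)) :=
  e.map (fun u => Finset.univ.filter (fun i => (G.deleteEdges {e}).Reachable (leaf i) u))

/-- `c(T)`: the set of splits of the phylogenetic tree. -/
def splitsOf {V : Type} [Fintype V] (n : ℕ) (G : SimpleGraph V) (leaf : Fin n → V) :
    Finset (Sym2 (Finset (Fin n))) :=
  G.edgeFinset.image (splitOfEdge n G leaf)

/-- A split is trivial if one of its sides is a singleton. -/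
def IsTrivialSplit {n : ℕ} (σ : Sym2 (Finset (Fin n))) : Prop :=
  ∃ A ∈ σ, A.card = 1

/-- The collection of split systems of fully resolved phylogenetic trees on `{1,…,n}`;
since a fully resolved phylogenetic tree is determined, up to isomorphism fixing the
leaf labels, by its set of splits, this collection is in bijection with `BPT(n)`.
(Every fully resolved tree on `n` leaves has `n-2` internal vertices, hence is
isomorphic to one with vertex set `Fin n ⊕ Fin (n-2)`, leaves labelled by `Sum.inl`.) -/
def allBPTSplits (n : ℕ) : Finset (Finset (Sym2 (Finset (Fin n)))) :=
  Finset.univ.filter (fun S => ∃ G : SimpleGraph (Fin n ⊕ Fin (n - 2)),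
    IsBinaryPhylo n G Sum.inl ∧ splitsOf n G Sum.inl = S)

/-- The number of cherries of the tree: pairs of (distinct) leaves adjacent to a
common vertex. -/
def numCherries {V : Type} [Fintype V] (n : ℕ) (G : SimpleGraph V) (leaf : Fin n → V) : ℕ :=
  (Finset.univ.filter
    (fun p : Sym2 (Fin n) => ¬ p.IsDiag ∧ ∃ v : V, ∀ i ∈ p, G.Adj (leaf i) v)).card

/-- The internal edges of the tree: edges both of whose endpoints are internal
(non-leaf) vertices. -/
def internalEdgesG {V : Type} [Fintype V] (n : ℕ) (G : SimpleGraph V) (leaf : Fin n → V) :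
    Finset (Sym2 V) :=
  G.edgeFinset.filter (fun e => ∀ v ∈ e, v ∉ Set.range leaf)

/-- `N_E(T) = ∏ᵢ β(|E̊(Fᵢ)|)`, the product over all connected components `Fᵢ` of the
forest `T - E` of the number `β(m) = b(m+3)` of fully resolved trees with `m` internal
edges, where `m = |E̊(Fᵢ)|` is the number of internal edges of `T` contained in `Fᵢ`. -/
def NEdges {V : Type} [Fintype V] (n : ℕ) (G : SimpleGraph V) (leaf : Fin n → V)
    (E : Finset (Sym2 V)) : ℕ :=
  ∏ C ∈ Finset.univ.image (G.deleteEdges (E : Set (Sym2 V))).connectedComponentMk,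
    numBPT ((((internalEdgesG n G leaf) \ E).filter
      (fun e => ∀ v ∈ e, (G.deleteEdges (E : Set (Sym2 V))).connectedComponentMk v = C)).card + 3)

/-- `r_s(T) = ∑_{E ⊆ E̊(T), |E| = s} N_E(T)`. -/
def rCoeff {V : Type} [Fintype V] (n : ℕ) (G : SimpleGraph V) (leaf : Fin n → V) (s : ℕ) : ℕ :=
  ∑ E ∈ (internalEdgesG n G leaf).powerset.filter (fun E => E.card = s), NEdges n G leaf E

/-- `q_s(T)`: the number of fully resolved phylogenetic trees on `{1,…,n}` (counted up
to isomorphism fixing leaf labels, i.e. counted via their split systems) sharing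
exactly `s` nontrivial splits with `T`. -/
def qCoeff {V : Type} [Fintype V] (n : ℕ) (G : SimpleGraph V) (leaf : Fin n → V) (s : ℕ) : ℕ :=
  ((allBPTSplits n).filter (fun S =>
    ((S ∩ splitsOf n G leaf).filter (fun σ => ¬ IsTrivialSplit σ)).card = s)).card

end


structure BinH {α : Type} [DecidableEq α] (X : Finset α) (P H : Finset (Finset α)) : Prop where
  top : X ∈ H
  sub : ∀ D ∈ H, D ⊆ X
  ne : ∀ D ∈ H, D.Nonempty
  atm : P ⊆ H
  mn : ∀ p ∈ P, ∀ D ∈ H, D ⊆ p → D = p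
  nd : ∀ D ∈ H, D ∉ P → ∃ A ∈ H, ∃ B ∈ H, Disjoint A B ∧ A ∪ B = D ∧
    ∀ D' ∈ H, D' ⊂ D → D' ⊆ A ∨ D' ⊆ B

namespace BinH

variable {α : Type} [DecidableEq α] {X : Finset α} {P H : Finset (Finset α)}

theorem lam (h : BinH X P H) {D D' : Finset α} (hD : D ∈ H) (hD' : D' ∈ H) :
    D ⊆ D' ∨ D' ⊆ D ∨ Disjoint D D' := by
  suffices ∀ k : ℕ, ∀ C ∈ H, C.card = k → D ⊆ C → D' ⊆ C → D ⊆ D' ∨ D' ⊆ D ∨ Disjoint D D' from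
    this _ X h.top rfl (h.sub _ hD) (h.sub _ hD')
  intro k
  induction k using Nat.strong_induction_on with
  | _ k ih =>
    intro C hC hk h1 h2
    by_cases e1 : D = C
    · subst e1; exact Or.inr (Or.inl h2)
    by_cases e2 : D' = C
    · subst e2; exact Or.inl h1
    by_cases hP : C ∈ P
    · exact absurd (h.mn _ hP _ hD h1) e1
    obtain ⟨A, hA, B, hB, hAB, rfl, hs⟩ := h.nd C hC hP
    have nA := h.ne _ hA
    have nB := h.ne _ hB
    have cA := Finset.card_union_of_disjoint hAB
    have := nA.card_pos
    have := nB.card_pos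
    rcases hs D hD (lt_of_le_of_ne h1 e1) with q1 | q1 <;>
      rcases hs D' hD' (lt_of_le_of_ne h2 e2) with q2 | q2
    · exact ih A.card (by omega) A hA rfl q1 q2
    · exact Or.inr (Or.inr (Disjoint.mono q1 q2 hAB))
    · exact Or.inr (Or.inr (Disjoint.mono q1 q2 hAB.symm))
    · exact ih B.card (by omega) B hB rfl q1 q2

theorem cover (h : BinH X P H) {D : Finset α} (hD : D ∈ H) {x : α} (hx : x ∈ D) :
    ∃ p ∈ P, x ∈ p ∧ p ⊆ D := by
  suffices ∀ k : ℕ, ∀ D ∈ H, D.card = k → x ∈ D → ∃ p ∈ P, x ∈ p ∧ p ⊆ D from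
    this _ D hD rfl hx
  intro k
  induction k using Nat.strong_induction_on with
  | _ k ih =>
    intro C hC hk h1
    by_cases hP : C ∈ P
    · exact ⟨C, hP, h1, subset_rfl⟩
    obtain ⟨A, hA, B, hB, hAB, rfl, hs⟩ := h.nd C hC hP
    have nA := (h.ne _ hA).card_pos
    have nB := (h.ne _ hB).card_pos
    have cA := Finset.card_union_of_disjoint hAB
    rcases Finset.mem_union.1 h1 with q | q
    · obtain ⟨p, hp, h3, h4⟩ := ih A.card (by omega) A hA rfl q
      exact ⟨p, hp, h3, h4.trans Finset.subset_union_left⟩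
    · obtain ⟨p, hp, h3, h4⟩ := ih B.card (by omega) B hB rfl q
      exact ⟨p, hp, h3, h4.trans Finset.subset_union_right⟩

theorem sup_eq (h : BinH X P H) : P.sup id = X := by
  apply le_antisymm
  · exact Finset.sup_le fun p hp => h.sub _ (h.atm hp)
  · intro x hx
    obtain ⟨p, hp, h3, h4⟩ := h.cover h.top hx
    exact Finset.mem_of_subset (Finset.le_sup (f := id) hp) h3

theorem atoms_disj (h : BinH X P H) {p q : Finset α} (hp : p ∈ P) (hq : q ∈ P) (hpq : p ≠ q) :
    Disjoint p q := by
  rcases h.lam (h.atm hp) (h.atm hq) with a | a | a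
  · exact absurd (h.mn _ hq _ (h.atm hp) a) hpq
  · exact absurd (h.mn _ hp _ (h.atm hq) a).symm hpq
  · exact a

/-- strict version of node -/
theorem nd' (h : BinH X P H) {D : Finset α} (hD : D ∈ H) (hP : D ∉ P) :
    ∃ A ∈ H, ∃ B ∈ H, Disjoint A B ∧ A ∪ B = D ∧ A ⊂ D ∧ B ⊂ D ∧
    ∀ D' ∈ H, D' ⊂ D → D' ⊆ A ∨ D' ⊆ B := by
  obtain ⟨A, hA, B, hB, hAB, rfl, hs⟩ := h.nd D hD hP
  obtain ⟨x, hx⟩ := h.ne _ hA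
  obtain ⟨y, hy⟩ := h.ne _ hB
  refine ⟨A, hA, B, hB, hAB, rfl, ?_, ?_, hs⟩
  · refine ⟨Finset.subset_union_left, fun hh => ?_⟩
    exact Finset.disjoint_left.1 hAB (hh (Finset.mem_union_right _ hy)) hy
  · refine ⟨Finset.subset_union_right, fun hh => ?_⟩
    exact Finset.disjoint_left.1 hAB hx (hh (Finset.mem_union_left _ hx))

theorem exists_atom (h : BinH X P H) {D : Finset α} (hD : D ∈ H) : ∃ p ∈ P, p ⊆ D := by
  obtain ⟨x, hx⟩ := h.ne _ hD
  obtain ⟨p, hp, _, h2⟩ := h.cover hD hx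
  exact ⟨p, hp, h2⟩

theorem single_iff {p : Finset α} (hp : p.Nonempty) : BinH p {p} H ↔ H = {p} := by
  constructor
  · intro h
    ext D
    rw [Finset.mem_singleton]
    constructor
    · intro hD
      exact h.mn p (by simp) D hD (h.sub _ hD)
    · rintro rfl
      exact h.top
  · rintro rfl
    refine ⟨by simp, by simp, by simpa using hp, by simp, by simp, by simp⟩

/-- inserting atom `a` at edge above `D` -/
def ins (a : Finset α) (H : Finset (Finset α)) (D : Finset α) : Finset (Finset α) :=
  insert a (H.filter (fun E => ¬ D ⊂ E) ∪ (H.filter (fun E => D ⊆ E)).image (fun E => E ∪ a))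

theorem mem_ins {a D E : Finset α} : E ∈ ins a H D ↔
    E = a ∨ (E ∈ H ∧ ¬ D ⊂ E) ∨ ∃ F ∈ H, D ⊆ F ∧ F ∪ a = E := by
  simp [ins, and_assoc]

def del (a : Finset α) (H : Finset (Finset α)) : Finset (Finset α) :=
  (H.erase a).image (fun E => E \ a)

theorem mem_del {a E : Finset α} : E ∈ del a H ↔ ∃ F ∈ H, F ≠ a ∧ F \ a = E := by
  simp [del, and_assoc, and_left_comm]

end BinH

namespace BinH

variable {α : Type} [DecidableEq α] {X : Finset α} {P H : Finset (Finset α)}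

theorem notsub {A B C : Finset α} (h : Disjoint A B) (hC : C.Nonempty) (h1 : C ⊆ A) (h2 : C ⊆ B) :
    False := by
  obtain ⟨x, hx⟩ := hC
  exact Finset.disjoint_left.1 h (h1 hx) (h2 hx)

theorem ins_bin {a D : Finset α} (h : BinH X P H) (ha : a.Nonempty) (haX : Disjoint a X)
    (hD : D ∈ H) : BinH (X ∪ a) (insert a P) (ins a H D) := by
  have hda : ∀ E ∈ H, Disjoint a E := fun E hE => haX.mono_right (h.sub E hE)
  have hna : ∀ E ∈ H, ¬ a ⊆ E := fun E hE hh => notsub (hda E hE) ha subset_rfl hh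
  have hu : ∀ E F : Finset α, E ∈ H → F ∪ a ⊆ E → False := fun E F hE hh =>
    hna E hE (Finset.subset_union_right.trans hh)
  have hcanc : ∀ E ∈ H, ∀ F, E ⊆ F ∪ a → E ⊆ F := by
    intro E hE F hh x hx
    rcases Finset.mem_union.1 (hh hx) with q | q
    · exact q
    · exact absurd hx (Finset.disjoint_left.1 (hda E hE) q)
  refine ⟨?_, ?_, ?_, ?_, ?_, ?_⟩
  · rw [mem_ins]
    exact Or.inr (Or.inr ⟨X, h.top, h.sub _ hD, rfl⟩)
  · intro E hE
    rcases mem_ins.1 hE with rfl | ⟨h1, h2⟩ | ⟨F, h1, h2, rfl⟩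
    · exact Finset.subset_union_right
    · exact (h.sub _ h1).trans Finset.subset_union_left
    · exact Finset.union_subset_union_left (h.sub _ h1)
  · intro E hE
    rcases mem_ins.1 hE with rfl | ⟨h1, h2⟩ | ⟨F, h1, h2, rfl⟩
    · exact ha
    · exact h.ne _ h1
    · exact ha.mono Finset.subset_union_right
  · intro E hE
    rw [mem_ins]
    rcases Finset.mem_insert.1 hE with rfl | hE
    · exact Or.inl rfl
    · refine Or.inr (Or.inl ⟨h.atm hE, fun hh => ?_⟩)
      exact hh.ne (h.mn _ hE _ hD hh.1)
  · intro p hp E hE hEp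
    rcases Finset.mem_insert.1 hp with rfl | hp'
    · rcases mem_ins.1 hE with rfl | ⟨h1, h2⟩ | ⟨F, h1, h2, rfl⟩
      · rfl
      · exact (notsub (hda E h1) (h.ne _ h1) hEp subset_rfl).elim
      · exact (notsub (hda F h1) (h.ne _ h1) (Finset.subset_union_left.trans hEp) subset_rfl).elim
    · rcases mem_ins.1 hE with rfl | ⟨h1, h2⟩ | ⟨F, h1, h2, rfl⟩
      · exact (hna p (h.atm hp') hEp).elim
      · exact h.mn p hp' E h1 hEp
      · exact (hu p F (h.atm hp') hEp).elim
  · intro E hE hEP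
    rcases mem_ins.1 hE with rfl | ⟨h1, h2⟩ | ⟨F, h1, h2, rfl⟩
    · simp at hEP
    · have hEP' : E ∉ P := fun hh => hEP (Finset.mem_insert_of_mem hh)
      obtain ⟨A, hA, B, hB, hAB, hABE, sA, sB, hs⟩ := h.nd' h1 hEP'
      refine ⟨A, mem_ins.2 (Or.inr (Or.inl ⟨hA, fun hh => h2 (hh.trans sA)⟩)), B,
        mem_ins.2 (Or.inr (Or.inl ⟨hB, fun hh => h2 (hh.trans sB)⟩)), hAB, hABE, ?_⟩
      intro D' hD' hlt
      rcases mem_ins.1 hD' with rfl | ⟨h1', h2'⟩ | ⟨F, h1', h2', rfl⟩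
      · exact (hna E h1 hlt.1).elim
      · exact hs D' h1' hlt
      · exact (hu E F h1 hlt.1).elim
    · by_cases hDF : D = F
      · subst hDF
        refine ⟨D, mem_ins.2 (Or.inr (Or.inl ⟨hD, fun hh => hh.ne rfl⟩)), a,
          mem_ins.2 (Or.inl rfl), (hda D hD).symm, rfl, ?_⟩
        intro D' hD' hlt
        rcases mem_ins.1 hD' with rfl | ⟨h1', h2'⟩ | ⟨F, h1', h2', rfl⟩
        · exact Or.inr subset_rfl
        · exact Or.inl (hcanc _ h1' _ hlt.1)
        · exact (hlt.2 (Finset.union_subset_union_left h2')).elim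
      · have hlt : D ⊂ F := lt_of_le_of_ne h2 hDF
        have hFP : F ∉ P := fun hh => hDF (h.mn _ hh _ hD h2)
        have key : ∀ A ∈ H, ∀ B ∈ H, Disjoint A B → A ∪ B = F → A ⊂ F → B ⊂ F →
            (∀ D' ∈ H, D' ⊂ F → D' ⊆ A ∨ D' ⊆ B) → D ⊆ A → 
            ∃ A ∈ ins a H D, ∃ B ∈ ins a H D, Disjoint A B ∧ A ∪ B = F ∪ a ∧
              ∀ D' ∈ ins a H D, D' ⊂ F ∪ a → D' ⊆ A ∨ D' ⊆ B := by
          intro A hA B hB hAB hABE sA sB hs hDA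
          refine ⟨A ∪ a, mem_ins.2 (Or.inr (Or.inr ⟨A, hA, hDA, rfl⟩)), B,
            mem_ins.2 (Or.inr (Or.inl ⟨hB, fun hh => notsub hAB (h.ne _ hD) hDA hh.1⟩)), ?_, ?_, ?_⟩
          · rw [Finset.disjoint_union_left]
            exact ⟨hAB, hda B hB⟩
          · rw [← hABE, Finset.union_right_comm]
          · intro D' hD' hlt'
            rcases mem_ins.1 hD' with rfl | ⟨h1', h2'⟩ | ⟨F', h1', h2', rfl⟩
            · exact Or.inl Finset.subset_union_right
            · have q1 := hcanc _ h1' _ hlt'.1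
              have q2 : D' ≠ F := by rintro rfl; exact h2' hlt
              rcases hs D' h1' (lt_of_le_of_ne q1 q2) with r | r
              · exact Or.inl (r.trans Finset.subset_union_left)
              · exact Or.inr r
            · have q1 := hcanc F' h1' F (Finset.subset_union_left.trans hlt'.1)
              have q2 : F' ≠ F := by rintro rfl; exact hlt'.ne rfl
              rcases hs F' h1' (lt_of_le_of_ne q1 q2) with r | r
              · exact Or.inl (Finset.union_subset_union_left r)
              · exact (notsub hAB (h.ne _ hD) hDA (h2'.trans r)).elim
        obtain ⟨A, hA, B, hB, hAB, hABE, sA, sB, hs⟩ := h.nd' h1 hFP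
        rcases hs D hD hlt with q | q
        · exact key A hA B hB hAB hABE sA sB hs q
        · exact key B hB A hA hAB.symm (by rw [Finset.union_comm]; exact hABE) sB sA
            (fun D' h1 h2 => (hs D' h1 h2).symm) q

theorem del_ins {a D : Finset α} (h : BinH X P H) (ha : a.Nonempty) (haX : Disjoint a X)
    (hD : D ∈ H) : del a (ins a H D) = H := by
  have hda : ∀ E ∈ H, Disjoint a E := fun E hE => haX.mono_right (h.sub E hE)
  have hsd : ∀ E ∈ H, E \ a = E := fun E hE => Finset.sdiff_eq_self_of_disjoint (hda E hE).symm
  have hsu : ∀ E ∈ H, (E ∪ a) \ a = E := fun E hE => by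
    rw [Finset.union_sdiff_right, hsd E hE]
  ext E
  rw [mem_del]
  constructor
  · rintro ⟨F, hF, hFa, rfl⟩
    rcases mem_ins.1 hF with rfl | ⟨h1, h2⟩ | ⟨F, h1, h2, rfl⟩
    · exact absurd rfl hFa
    · rwa [hsd F h1]
    · rwa [hsu F h1]
  · intro hE
    by_cases hDE : D ⊆ E
    · refine ⟨E ∪ a, mem_ins.2 (Or.inr (Or.inr ⟨E, hE, hDE, rfl⟩)), ?_, hsu E hE⟩
      intro hh
      exact notsub (hda E hE) (h.ne _ hE) (hh ▸ Finset.subset_union_left) subset_rfl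
    · refine ⟨E, mem_ins.2 (Or.inr (Or.inl ⟨hE, fun hh => hDE hh.1⟩)), ?_, hsd E hE⟩
      rintro rfl
      exact notsub (hda E hE) (h.ne _ hE) subset_rfl subset_rfl

theorem ins_inj {a D D' : Finset α} (h : BinH X P H) (ha : a.Nonempty) (haX : Disjoint a X)
    (hD : D ∈ H) (hD' : D' ∈ H) (he : ins a H D = ins a H D') : D = D' := by
  have hda : ∀ E ∈ H, Disjoint a E := fun E hE => haX.mono_right (h.sub E hE)
  have hsd : ∀ E ∈ H, E \ a = E := fun E hE => Finset.sdiff_eq_self_of_disjoint (hda E hE).symm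
  have hsu : ∀ E ∈ H, (E ∪ a) \ a = E := fun E hE => by
    rw [Finset.union_sdiff_right, hsd E hE]
  have key : ∀ D ∈ H, ∀ D' ∈ H, ins a H D = ins a H D' → D ⊆ D' := by
    intro D hD D' hD' he
    have : D' ∪ a ∈ ins a H D := by
      rw [he]; exact mem_ins.2 (Or.inr (Or.inr ⟨D', hD', subset_rfl, rfl⟩))
    rcases mem_ins.1 this with h1 | ⟨h1, h2⟩ | ⟨F, h1, h2, h3⟩
    · exact (notsub (hda D' hD') (h.ne _ hD') (h1 ▸ Finset.subset_union_left) subset_rfl).elim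
    · exact (notsub (hda _ h1) ha subset_rfl Finset.subset_union_right).elim
    · have := congrArg (· \ a) h3
      simp only [hsu F h1, hsu D' hD'] at this
      exact this ▸ h2
  exact (key D hD D' hD' he).antisymm (key D' hD' D hD he.symm)

theorem card_ins {a D : Finset α} (h : BinH X P H) (ha : a.Nonempty) (haX : Disjoint a X)
    (hD : D ∈ H) : (ins a H D).card = H.card + 2 := by
  have hda : ∀ E ∈ H, Disjoint a E := fun E hE => haX.mono_right (h.sub E hE)
  have hsd : ∀ E ∈ H, E \ a = E := fun E hE => Finset.sdiff_eq_self_of_disjoint (hda E hE).symm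
  have hsu : ∀ E ∈ H, (E ∪ a) \ a = E := fun E hE => by
    rw [Finset.union_sdiff_right, hsd E hE]
  unfold ins
  rw [Finset.card_insert_of_notMem, Finset.card_union_of_disjoint, Finset.card_image_of_injOn]
  · have h1 := Finset.card_filter_add_card_filter_not (s := H) (fun E => D ⊂ E)
    have h2 : H.filter (fun E => D ⊆ E) = insert D (H.filter (fun E => D ⊂ E)) := by
      ext E
      simp only [Finset.mem_filter, Finset.mem_insert]
      constructor
      · rintro ⟨q1, q2⟩
        by_cases e : E = D
        · exact Or.inl e
        · exact Or.inr ⟨q1, lt_of_le_of_ne q2 (Ne.symm e)⟩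
      · rintro (rfl | ⟨q1, q2⟩)
        · exact ⟨hD, subset_rfl⟩
        · exact ⟨q1, q2.1⟩
    rw [h2, Finset.card_insert_of_notMem (by simp)]
    omega
  · intro E hE F hF hEF
    simp only [Finset.coe_filter, Set.mem_ofPred_eq] at hE hF
    have := congrArg (· \ a) hEF
    simpa only [hsu E hE.1, hsu F hF.1] using this
  · rw [Finset.disjoint_left]
    intro E hE hE'
    simp only [Finset.mem_filter, Finset.mem_image] at hE hE'
    obtain ⟨F, hF, rfl⟩ := hE'
    exact notsub (hda _ hE.1) ha subset_rfl Finset.subset_union_right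
  · intro hh
    simp only [Finset.mem_union, Finset.mem_filter, Finset.mem_image] at hh
    rcases hh with hh | ⟨F, hF, hh⟩
    · exact notsub (hda _ hh.1) ha subset_rfl subset_rfl
    · exact notsub (hda F hF.1) (h.ne _ hF.1) (hh ▸ Finset.subset_union_left) subset_rfl

theorem ins_surj {a : Finset α} (haX : Disjoint a X) (haP : a ∉ P) (hX : X.Nonempty)
    (h : BinH (X ∪ a) (insert a P) H) :
    BinH X P (del a H) ∧ ∃ D ∈ del a H, ins a (del a H) D = H := by
  have haH : a ∈ H := h.atm (Finset.mem_insert_self _ _)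
  have ha : a.Nonempty := h.ne _ haH
  -- parent of a
  have hex : ∃ D ∈ H, Disjoint D a ∧ D ∪ a ∈ H := by
    have hne : (H.filter (fun E => a ⊂ E)).Nonempty := by
      refine ⟨X ∪ a, Finset.mem_filter.2 ⟨h.top, Finset.subset_union_right, fun hh => ?_⟩⟩
      exact notsub haX hX (Finset.subset_union_left.trans hh) subset_rfl
    obtain ⟨E, hE, hmin⟩ := Finset.exists_min_image _ Finset.card hne
    rw [Finset.mem_filter] at hE
    have hEP : E ∉ insert a P := fun hh => hE.2.ne (h.mn _ hh _ haH hE.2.1)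
    obtain ⟨A, hA, B, hB, hAB, hABE, sA, sB, hs⟩ := h.nd' hE.1 hEP
    have key : ∀ A ∈ H, A ⊂ E → a ⊆ A → a = A := by
      intro A hA sA haA
      by_contra hne
      have := hmin A (Finset.mem_filter.2 ⟨hA, lt_of_le_of_ne haA hne⟩)
      have := Finset.card_lt_card sA
      omega
    rcases hs a haH hE.2 with q | q
    · have := key A hA sA q
      subst this
      exact ⟨B, hB, hAB.symm, by rw [Finset.union_comm, hABE]; exact hE.1⟩
    · have := key B hB sB q
      subst this
      exact ⟨A, hA, hAB, by rw [hABE]; exact hE.1⟩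
  obtain ⟨D, hD, hDa, hE0⟩ := hex
  have hDn := h.ne _ hD
  have hcase : ∀ E ∈ H, E = a ∨ Disjoint E a ∨ D ∪ a ⊆ E := by
    intro E hE
    rcases h.lam hE haH with q | q | q
    · exact Or.inl (h.mn a (by simp) E hE q)
    · by_cases hEa : E = a
      · exact Or.inl hEa
      rcases h.lam hE hE0 with r | r | r
      · by_cases e : E = D ∪ a
        · exact Or.inr (Or.inr e.ge)
        have hP : D ∪ a ∉ insert a P := by
          intro hh
          have := h.mn _ hh a haH Finset.subset_union_right
          exact notsub hDa hDn subset_rfl (Finset.subset_union_left.trans this.symm.subset)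
        obtain ⟨A, hA, B, hB, hAB, hABE, sA, sB, hs⟩ := h.nd' hE0 hP
        -- E strictly contains a, inside D ∪ a
        exfalso
        have hlam := h.lam hE hD
        rcases hlam with u | u | u
        · exact notsub hDa ha (q.trans u) subset_rfl
        · exact e (r.antisymm (Finset.union_subset u q))
        · apply hEa
          refine Finset.Subset.antisymm ?_ q
          intro x hx
          rcases Finset.mem_union.1 (r hx) with v | v
          · exact absurd v (Finset.disjoint_left.1 u hx)
          · exact v
      · exact Or.inr (Or.inr r)
      · exact (notsub r ha q Finset.subset_union_right).elim
    · exact Or.inr (Or.inl q)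
  have hDE : ∀ E ∈ H, Disjoint E a → D ⊆ E → E = D := by
    intro E hE hEa hDE
    rcases h.lam hE hE0 with r | r | r
    · refine Finset.Subset.antisymm ?_ hDE
      intro x hx
      rcases Finset.mem_union.1 (r hx) with v | v
      · exact v
      · exact absurd v (Finset.disjoint_left.1 hEa hx)
    · exact (notsub hEa ha (Finset.subset_union_right.trans r) subset_rfl).elim
    · exact (notsub r hDn hDE Finset.subset_union_left).elim
  have hsd : ∀ E : Finset α, Disjoint E a → E \ a = E :=
    fun E hE => Finset.sdiff_eq_self_of_disjoint hE
  have hsda : ∀ E : Finset α, a ⊆ E → E \ a ∪ a = E := fun E hE => Finset.sdiff_union_of_subset hE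
  have hDd : D ∈ del a H := mem_del.2 ⟨D, hD, by
    rintro rfl; exact notsub hDa hDn subset_rfl subset_rfl, hsd D hDa⟩
  have hPne : ∀ p ∈ P, p ≠ a := by rintro p hp rfl; exact haP hp
  have hPd : ∀ p ∈ P, Disjoint p a := fun p hp =>
    h.atoms_disj (Finset.mem_insert_of_mem hp) (Finset.mem_insert_self _ _) (hPne p hp)
  refine ⟨⟨?_, ?_, ?_, ?_, ?_, ?_⟩, D, hDd, ?_⟩
  · refine mem_del.2 ⟨X ∪ a, h.top, ?_, ?_⟩
    · intro hh
      exact notsub haX hX (hh ▸ Finset.subset_union_left) subset_rfl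
    · rw [Finset.union_sdiff_right, hsd X haX.symm]
  · intro E hE
    obtain ⟨F, hF, hFa, rfl⟩ := mem_del.1 hE
    intro x hx
    rw [Finset.mem_sdiff] at hx
    have := h.sub F hF hx.1
    rw [Finset.mem_union] at this
    tauto
  · intro E hE
    obtain ⟨F, hF, hFa, rfl⟩ := mem_del.1 hE
    rw [Finset.sdiff_nonempty]
    exact fun hh => hFa (h.mn a (by simp) F hF hh)
  · intro p hp
    exact mem_del.2 ⟨p, h.atm (Finset.mem_insert_of_mem hp), hPne p hp, hsd p (hPd p hp)⟩
  · intro p hp E hE hEp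
    obtain ⟨F, hF, hFa, rfl⟩ := mem_del.1 hE
    rcases hcase F hF with r | r | r
    · exact absurd r hFa
    · rw [hsd F r] at hEp ⊢
      exact h.mn p (Finset.mem_insert_of_mem hp) F hF hEp
    · have : D ⊆ F \ a := by
        intro x hx
        exact Finset.mem_sdiff.2 ⟨r (Finset.mem_union_left _ hx), Finset.disjoint_left.1 hDa hx⟩
      have hDp := h.mn p (Finset.mem_insert_of_mem hp) D hD (this.trans hEp)
      subst hDp
      exact hEp.antisymm this
  · intro E hE hEP
    have hex : ∃ F ∈ H, F ≠ a ∧ F ≠ D ∪ a ∧ F \ a = E := by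
      obtain ⟨F, hF, hFa, rfl⟩ := mem_del.1 hE
      by_cases e : F = D ∪ a
      · refine ⟨D, hD, ?_, ?_, ?_⟩
        · rintro rfl; exact notsub hDa hDn subset_rfl subset_rfl
        · intro hh
          exact notsub hDa ha (hh ▸ Finset.subset_union_right) subset_rfl
        · rw [e, Finset.union_sdiff_right]
      · exact ⟨F, hF, hFa, e, rfl⟩
    obtain ⟨F, hF, hFa, hF0, rfl⟩ := hex
    have hFP : F ∉ insert a P := by
      intro hh
      rcases Finset.mem_insert.1 hh with r | r
      · exact hFa r
      · rw [hsd F (hPd F r)] at hEP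
        exact hEP r
    obtain ⟨A, hA, B, hB, hAB, hABE, sA, sB, hs⟩ := h.nd' hF hFP
    have hAa : ∀ A B, A ∈ H → B ∈ H → Disjoint A B → A ∪ B = F → A ⊂ F →
        (∀ D' ∈ H, D' ⊂ F → D' ⊆ A ∨ D' ⊆ B) → A ≠ a := by
      rintro A B hA hB hAB hABE sA hs rfl
      rcases hcase F hF with r | r | r
      · exact hFa r
      · exact notsub r ha sA.1 subset_rfl
      · rcases hs _ hE0 (lt_of_le_of_ne r (Ne.symm hF0)) with t | t
        · exact notsub hDa hDn subset_rfl (Finset.subset_union_left.trans t)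
        · exact notsub hAB ha subset_rfl (Finset.subset_union_right.trans t)
    refine ⟨A \ a, mem_del.2 ⟨A, hA, hAa A B hA hB hAB hABE sA hs, rfl⟩, B \ a,
      mem_del.2 ⟨B, hB, hAa B A hB hA hAB.symm (by rw [Finset.union_comm, hABE]) sB
        (fun D' a b => (hs D' a b).symm), rfl⟩,
      hAB.mono Finset.sdiff_subset Finset.sdiff_subset, by rw [← hABE, Finset.union_sdiff_distrib],
      ?_⟩
    intro E' hE' hlt
    obtain ⟨F', hF', hFa', rfl⟩ := mem_del.1 hE'
    rcases h.lam hF' hF with r | r | r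
    · have : F' ≠ F := by rintro rfl; exact hlt.ne rfl
      rcases hs F' hF' (lt_of_le_of_ne r this) with t | t
      · exact Or.inl (Finset.sdiff_subset_sdiff t subset_rfl)
      · exact Or.inr (Finset.sdiff_subset_sdiff t subset_rfl)
    · exact (hlt.2 (Finset.sdiff_subset_sdiff r subset_rfl)).elim
    · exfalso
      refine notsub r (C := F' \ a) ?_ Finset.sdiff_subset (hlt.1.trans Finset.sdiff_subset)
      rw [Finset.sdiff_nonempty]
      exact fun hh => hFa' (h.mn a (by simp) F' hF' hh)
  · ext E
    rw [mem_ins]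
    constructor
    · rintro (rfl | ⟨h1, h2⟩ | ⟨G, h1, h2, rfl⟩)
      · exact haH
      · obtain ⟨F, hF, hFa, rfl⟩ := mem_del.1 h1
        rcases hcase F hF with r | r | r
        · exact absurd r hFa
        · rwa [hsd F r]
        · have : D ⊆ F \ a := by
            intro x hx
            exact Finset.mem_sdiff.2 ⟨r (Finset.mem_union_left _ hx), Finset.disjoint_left.1 hDa hx⟩
          by_cases e : D = F \ a
          · rwa [← e]
          · exact absurd (lt_of_le_of_ne this e) h2
      · obtain ⟨F, hF, hFa, rfl⟩ := mem_del.1 h1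
        rcases hcase F hF with r | r | r
        · exact absurd r hFa
        · rw [hsd F r] at h2 ⊢
          rw [hDE F hF r h2]
          exact hE0
        · rwa [hsda F (Finset.subset_union_right.trans r)]
    · intro hE
      rcases hcase E hE with r | r | r
      · exact Or.inl r
      · right; left
        refine ⟨mem_del.2 ⟨E, hE, ?_, hsd E r⟩, fun hh => hh.ne (hDE E hE r hh.1).symm⟩
        rintro rfl
        exact notsub r ha subset_rfl subset_rfl
      · right; right
        refine ⟨E \ a, mem_del.2 ⟨E, hE, ?_, rfl⟩, ?_, hsda E (Finset.subset_union_right.trans r)⟩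
        · rintro rfl
          exact notsub hDa hDn subset_rfl (Finset.subset_union_left.trans r)
        · intro x hx
          exact Finset.mem_sdiff.2 ⟨r (Finset.mem_union_left _ hx), Finset.disjoint_left.1 hDa hx⟩

end BinH

namespace BinH

variable {α : Type} [DecidableEq α] {X : Finset α} {P H : Finset (Finset α)}

theorem disj_sup {a : Finset α} (hd : ∀ q ∈ P, Disjoint a q) : Disjoint a (P.sup id) := by
  rw [Finset.disjoint_sup_right]
  exact hd

theorem sup_ins {a : Finset α} : (insert a P).sup id = P.sup id ∪ a := by
  rw [Finset.sup_insert, sup_comm]; rfl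

theorem card_eq (P : Finset (Finset α)) : ∀ (X : Finset α) (H : Finset (Finset α)),
    BinH X P H → H.card + 1 = 2 * P.card := by
  induction P using Finset.induction_on with
  | empty =>
    intro X H h
    obtain ⟨p, hp, _⟩ := h.exists_atom h.top
    simp at hp
  | insert a P haP ih =>
    intro X H h
    have hX := h.sup_eq
    have hdis : Disjoint a (P.sup id) := disj_sup fun q hq =>
      h.atoms_disj (Finset.mem_insert_self _ _) (Finset.mem_insert_of_mem hq)
        (by rintro rfl; exact haP hq)
    have ha := h.ne _ (h.atm (Finset.mem_insert_self _ _))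
    by_cases hP : P = ∅
    · subst hP
      simp at hX
      subst hX
      simp only [insert_empty_eq] at h
      rw [single_iff ha] at h
      subst h
      simp
    · obtain ⟨p, hp⟩ := Finset.nonempty_iff_ne_empty.2 hP
      have hne : (P.sup id).Nonempty := (h.ne p (h.atm (Finset.mem_insert_of_mem hp))).mono
        (Finset.le_sup (f := id) hp)
      rw [sup_ins] at hX
      subst hX
      obtain ⟨h1, D, hD, h2⟩ := ins_surj hdis haP hne h
      have := card_ins h1 ha hdis hD
      rw [h2] at this
      have := ih _ _ h1
      rw [Finset.card_insert_of_notMem haP]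
      omega

theorem numBPT_succ (k : ℕ) (hk : 1 ≤ k) : numBPT (k + 1 + 1) = numBPT (k + 1) * (2 * k - 1) := by
  unfold numBPT
  rw [Finset.prod_Icc_succ_top (by omega)]
  congr 1

theorem count [Fintype α] (P : Finset (Finset α)) (hne : P.Nonempty)
    (hd : ∀ p ∈ P, ∀ q ∈ P, p ≠ q → Disjoint p q) (hn : ∀ p ∈ P, p.Nonempty) :
    (Finset.univ.filter (fun H => BinH (P.sup id) P H)).card = numBPT (P.card + 1) := by
  induction P using Finset.induction_on with
  | empty => simp at hne
  | insert a P haP ih =>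
    have hdis : Disjoint a (P.sup id) := disj_sup fun q hq =>
      hd a (Finset.mem_insert_self _ _) q (Finset.mem_insert_of_mem hq)
        (by rintro rfl; exact haP hq)
    have ha := hn a (Finset.mem_insert_self _ _)
    by_cases hP : P = ∅
    · subst hP
      simp only [insert_empty_eq, Finset.sup_singleton, id, single_iff ha]
      simp only [Finset.card_singleton, numBPT]
      rw [Finset.card_eq_one.2 ⟨{a}, by ext; simp⟩]
      simp
    · have hPn := Finset.nonempty_iff_ne_empty.2 hP
      obtain ⟨p, hp⟩ := hPn
      have hne' : (P.sup id).Nonempty := (hn p (Finset.mem_insert_of_mem hp)).mono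
        (Finset.le_sup (f := id) hp)
      have ih' := ih ⟨p, hp⟩ (fun p hp q hq => hd p (Finset.mem_insert_of_mem hp) q
        (Finset.mem_insert_of_mem hq)) (fun p hp => hn p (Finset.mem_insert_of_mem hp))
      have hpos : 1 ≤ P.card := Finset.card_pos.2 ⟨p, hp⟩
      rw [Finset.card_insert_of_notMem haP, numBPT_succ _ hpos, ← ih', sup_ins]
      rw [← Finset.sum_const_nat (f := fun H : Finset (Finset α) => H.card)]
      · rw [← Finset.card_sigma]
        symm
        refine Finset.card_bij (fun x _ => ins a x.1 x.2) ?_ ?_ ?_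
        · rintro ⟨H, D⟩ hx
          simp only [Finset.mem_sigma, Finset.mem_filter, Finset.mem_univ, true_and] at hx ⊢
          exact ins_bin hx.1 ha hdis hx.2
        · rintro ⟨H, D⟩ hx ⟨H', D'⟩ hx' he
          simp only [Finset.mem_sigma, Finset.mem_filter, Finset.mem_univ, true_and] at hx hx' he
          have e1 := del_ins hx.1 ha hdis hx.2
          have e2 := del_ins hx'.1 ha hdis hx'.2
          rw [he, e2] at e1
          subst e1
          have := ins_inj hx.1 ha hdis hx.2 hx'.2 he
          subst this
          rfl
        · intro H hH
          simp only [Finset.mem_filter, Finset.mem_univ, true_and] at hH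
          obtain ⟨h1, D, hD, h2⟩ := ins_surj hdis haP hne' hH
          exact ⟨⟨del a H, D⟩, by simp [h1, hD], h2⟩
      · intro H hH
        simp only [Finset.mem_filter, Finset.mem_univ, true_and] at hH
        have := card_eq _ _ _ hH
        omega

theorem count' [Fintype α] (h : BinH X P H) :
    (Finset.univ.filter (fun H => BinH X P H)).card = numBPT (P.card + 1) := by
  have := count P (by obtain ⟨p, hp, _⟩ := h.exists_atom h.top; exact ⟨p, hp⟩)
    (fun p hp q hq => h.atoms_disj hp hq) (fun p hp => h.ne _ (h.atm hp))
  rwa [h.sup_eq] at this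

theorem card_int (h : BinH X P H) : (H \ P).card + 1 = P.card := by
  have h1 := card_eq _ _ _ h
  have h2 := Finset.card_sdiff_add_card_eq_card h.atm
  omega

def lowP (C : Finset α) (P : Finset (Finset α)) := P.filter (fun A => A ⊆ C)
def lowH (C : Finset α) (H : Finset (Finset α)) := H.filter (fun A => A ⊆ C)
def upP (C : Finset α) (P : Finset (Finset α)) := insert C (P.filter (fun A => ¬ A ⊆ C))
def upH (C : Finset α) (H : Finset (Finset α)) := H.filter (fun A => ¬ A ⊂ C)

theorem low (h : BinH X P H) {C : Finset α} (hC : C ∈ H) : BinH C (lowP C P) (lowH C H) := by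
  refine ⟨?_, ?_, ?_, ?_, ?_, ?_⟩ <;> simp only [lowP, lowH, Finset.mem_filter]
  · exact ⟨hC, subset_rfl⟩
  · exact fun D hD => hD.2
  · exact fun D hD => h.ne _ hD.1
  · intro D hD
    rw [Finset.mem_filter] at hD ⊢
    exact ⟨h.atm hD.1, hD.2⟩
  · exact fun p hp D hD => h.mn p hp.1 D hD.1
  · intro D hD hDP
    obtain ⟨A, hA, B, hB, hAB, hABE, sA, sB, hs⟩ := h.nd' hD.1 (fun hh => hDP ⟨hh, hD.2⟩)
    exact ⟨A, ⟨hA, sA.1.trans hD.2⟩, B, ⟨hB, sB.1.trans hD.2⟩, hAB, hABE,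
      fun D' hD' => hs D' hD'.1⟩

theorem up (h : BinH X P H) {C : Finset α} (hC : C ∈ H) : BinH X (upP C P) (upH C H) := by
  refine ⟨?_, ?_, ?_, ?_, ?_, ?_⟩ <;> simp only [upP, upH, Finset.mem_filter, Finset.mem_insert]
  · exact ⟨h.top, fun hh => hh.2 (h.sub _ hC)⟩
  · exact fun D hD => h.sub D hD.1
  · exact fun D hD => h.ne _ hD.1
  · intro D hD
    rw [Finset.mem_insert, Finset.mem_filter] at hD
    rw [Finset.mem_filter]
    rcases hD with rfl | hD
    · exact ⟨hC, fun hh => hh.ne rfl⟩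
    · exact ⟨h.atm hD.1, fun hh => hD.2 hh.1⟩
  · rintro p (rfl | hp) D hD hDp
    · by_contra hne
      exact hD.2 (lt_of_le_of_ne hDp hne)
    · exact h.mn p hp.1 D hD.1 hDp
  · intro D hD hDP
    push Not at hDP
    have hDC : ¬ D ⊆ C := fun hh => hD.2 (lt_of_le_of_ne hh hDP.1)
    obtain ⟨A, hA, B, hB, hAB, hABE, sA, sB, hs⟩ := h.nd' hD.1 (fun hh => hDC (hDP.2 hh))
    have key : ∀ A ∈ H, ∀ B ∈ H, Disjoint A B → A ⊂ D → 
        (∀ D' ∈ H, D' ⊂ D → D' ⊆ A ∨ D' ⊆ B) → ¬ A ⊂ C := by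
      intro A hA B hB hAB sA hs hAC
      rcases h.lam hD.1 hC with r | r | r
      · exact hDC r
      · rcases hs C hC (lt_of_le_of_ne r hDP.1.symm) with t | t
        · exact hAC.2 t
        · exact notsub hAB (h.ne _ hA) subset_rfl (hAC.1.trans t)
      · exact notsub r (h.ne _ hA) sA.1 hAC.1
    exact ⟨A, ⟨hA, key A hA B hB hAB sA hs⟩, B, ⟨hB, key B hB A hA hAB.symm sB
      (fun D' a b => (hs D' a b).symm)⟩, hAB, hABE,
      fun D' hD' => hs D' hD'.1⟩

theorem join {C : Finset α} {H1 H2 : Finset (Finset α)} 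
    (hP : P ⊆ lowP C P ∪ upP C P)
    (h1 : BinH C (lowP C P) H1) (h2 : BinH X (upP C P) H2) (hPm : ∀ p ∈ P, C ⊆ p → p = C) :
    BinH X P (H1 ∪ H2) := by
  have hC2 : C ∈ H2 := h2.atm (Finset.mem_insert_self _ _)
  have hCup : C ∈ upP C P := Finset.mem_insert_self _ _
  have hC1 : C ∈ H1 := h1.top
  have hc2 : ∀ D ∈ H2, D ⊆ C → D = C := h2.mn C (Finset.mem_insert_self _ _)
  refine ⟨?_, ?_, ?_, ?_, ?_, ?_⟩
  · exact Finset.mem_union_right _ h2.top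
  · intro D hD
    rcases Finset.mem_union.1 hD with r | r
    · exact (h1.sub D r).trans (h2.sub C hC2)
    · exact h2.sub D r
  · intro D hD
    rcases Finset.mem_union.1 hD with r | r
    · exact h1.ne D r
    · exact h2.ne D r
  · exact hP.trans (Finset.union_subset_union h1.atm h2.atm)
  · intro p hp D hD hDp
    by_cases hpC : p ⊆ C
    · have hp' : p ∈ lowP C P := Finset.mem_filter.2 ⟨hp, hpC⟩
      rcases Finset.mem_union.1 hD with r | r
      · exact h1.mn p hp' D r hDp
      · have e := hc2 D r (hDp.trans hpC)
        exact hDp.antisymm (by rw [e]; exact hpC)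
    · have hp' : p ∈ upP C P := Finset.mem_insert_of_mem (Finset.mem_filter.2 ⟨hp, hpC⟩)
      rcases Finset.mem_union.1 hD with r | r
      · exfalso
        have hpne : p ≠ C := by rintro rfl; exact hpC subset_rfl
        exact notsub (h2.atoms_disj hp' hCup hpne) (h1.ne _ r) hDp (h1.sub _ r)
      · exact h2.mn p hp' D r hDp
  · intro D hD hDP
    by_cases hDC : D ∈ H1
    · obtain ⟨A, hA, B, hB, hAB, hABE, sA, sB, hs⟩ := h1.nd' hDC
        (fun hh => hDP (Finset.mem_filter.1 hh).1)
      refine ⟨A, Finset.mem_union_left _ hA, B, Finset.mem_union_left _ hB, hAB, hABE, ?_⟩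
      intro D' hD' hlt
      rcases Finset.mem_union.1 hD' with r | r
      · exact hs D' r hlt
      · exfalso
        have e := hc2 D' r (hlt.1.trans (h1.sub _ hDC))
        exact hlt.2 (by rw [e]; exact h1.sub _ hDC)
    · have hD2 : D ∈ H2 := (Finset.mem_union.1 hD).resolve_left hDC
      have hDne : D ≠ C := by rintro rfl; exact hDC hC1
      have hDup : D ∉ upP C P := by
        intro hh
        rcases Finset.mem_insert.1 hh with r | r
        · exact hDne r
        · exact hDP (Finset.mem_filter.1 r).1
      obtain ⟨A, hA, B, hB, hAB, hABE, sA, sB, hs⟩ := h2.nd' hD2 hDup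
      refine ⟨A, Finset.mem_union_right _ hA, B, Finset.mem_union_right _ hB, hAB, hABE, ?_⟩
      intro D' hD' hlt
      rcases Finset.mem_union.1 hD' with r | r
      · have hD'C := h1.sub _ r
        rcases h2.lam hD2 hC2 with t | t | t
        · exact absurd (hc2 D hD2 t) hDne
        · rcases hs C hC2 (lt_of_le_of_ne t hDne.symm) with u | u
          · exact Or.inl (hD'C.trans u)
          · exact Or.inr (hD'C.trans u)
        · exact (notsub t (h1.ne _ r) hlt.1 hD'C).elim
      · exact hs D' r hlt

theorem count_mul [Fintype α] (h : BinH X P H) {C : Finset α} (hC : C ∈ H)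
    {E : Finset (Finset α)} (hEH : E ⊆ H) (hmin : ∀ D ∈ E, ¬ D ⊂ C) :
    (Finset.univ.filter (fun H => BinH X P H ∧ C ∈ H ∧ E ⊆ H)).card =
      (Finset.univ.filter (fun H => BinH C (lowP C P) H)).card *
      (Finset.univ.filter (fun H => BinH X (upP C P) H ∧ E ⊆ H)).card := by
  rw [← Finset.card_product]
  have hP : P ⊆ lowP C P ∪ upP C P := by
    intro p hp
    by_cases hpC : p ⊆ C
    · exact Finset.mem_union_left _ (Finset.mem_filter.2 ⟨hp, hpC⟩)
    · exact Finset.mem_union_right _ (Finset.mem_insert_of_mem (Finset.mem_filter.2 ⟨hp, hpC⟩))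
  have hPm : ∀ p ∈ P, C ⊆ p → p = C := fun p hp hh => (h.mn p hp C hC hh).symm
  refine Finset.card_bij' (fun H _ => (lowH C H, upH C H)) (fun x _ => x.1 ∪ x.2) ?_ ?_ ?_ ?_
  · intro K hK
    simp only [Finset.mem_filter, Finset.mem_univ, true_and, Finset.mem_product] at hK ⊢
    refine ⟨hK.1.low hK.2.1, hK.1.up hK.2.1, fun D hD => Finset.mem_filter.2 ⟨hK.2.2 hD, hmin D hD⟩⟩
  · rintro ⟨H1, H2⟩ hx
    simp only [Finset.mem_filter, Finset.mem_univ, true_and, Finset.mem_product] at hx ⊢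
    exact ⟨join hP hx.1 hx.2.1 hPm, Finset.mem_union_left _ hx.1.top,
      hx.2.2.trans Finset.subset_union_right⟩
  · intro K hK
    ext D
    simp only [Finset.mem_union, lowH, upH, Finset.mem_filter]
    constructor
    · rintro (r | r)
      · exact r.1
      · exact r.1
    · intro hD
      by_cases hDC : D ⊆ C
      · exact Or.inl ⟨hD, hDC⟩
      · exact Or.inr ⟨hD, fun hh => hDC hh.1⟩
  · rintro ⟨H1, H2⟩ hx
    simp only [Finset.mem_filter, Finset.mem_univ, true_and, Finset.mem_product] at hx
    have hc2 := hx.2.1.mn C (Finset.mem_insert_self _ _)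
    have hC1 := hx.1.top
    have hC2 : C ∈ H2 := hx.2.1.atm (Finset.mem_insert_self _ _)
    have hs1 := hx.1.sub
    have e1 : lowH C (H1 ∪ H2) = H1 := by
      ext D
      simp only [lowH, Finset.mem_filter, Finset.mem_union]
      constructor
      · rintro ⟨r | r, hh⟩
        · exact r
        · rw [hc2 D r hh]; exact hC1
      · intro hD
        exact ⟨Or.inl hD, hs1 D hD⟩
    have e2 : upH C (H1 ∪ H2) = H2 := by
      ext D
      simp only [upH, Finset.mem_filter, Finset.mem_union]
      constructor
      · rintro ⟨r | r, hh⟩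
        · by_cases e : D = C
          · rw [e]; exact hC2
          · exact absurd (lt_of_le_of_ne (hs1 D r) e) hh
        · exact r
      · intro hD
        exact ⟨Or.inr hD, fun hh => hh.ne (hc2 D hD hh.1)⟩
    simp only [e1, e2]

theorem count_prod [Fintype α] (k : ℕ) : ∀ (E : Finset (Finset α)) (X : Finset α)
    (P H : Finset (Finset α)), E.card = k → BinH X P H → E ⊆ H \ P → X ∉ E → 
    X ∉ P →
    (Finset.univ.filter (fun K => BinH X P K ∧ E ⊆ K)).card =
      numBPT (((H \ P).filter (fun D => ∀ C' ∈ E, ¬ D ⊆ C')).card + 2) *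
      ∏ C ∈ E, numBPT (((H \ P).filter
        (fun D => D ⊆ C ∧ ∀ C' ∈ E, C' ⊂ C → ¬ D ⊆ C')).card + 2) := by
  induction k with
  | zero =>
    intro E X P H hE h _ _ _
    rw [Finset.card_eq_zero] at hE
    subst hE
    simp only [Finset.empty_subset, and_true, Finset.prod_empty, mul_one]
    rw [h.count', ← h.card_int]
    simp
  | succ k ih =>
    intro E X P H hE h hEH hXE hXP
    have hne : E.Nonempty := by rw [← Finset.card_pos]; omega
    obtain ⟨C, hCE, hCmin⟩ := Finset.exists_min_image E Finset.card hne
    have hCmin' : ∀ D ∈ E, ¬ D ⊂ C := fun D hD hlt => by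
      have := hCmin D hD
      have := Finset.card_lt_card hlt
      omega
    have hCH : C ∈ H := (Finset.mem_sdiff.1 (hEH hCE)).1
    have hCP : C ∉ P := (Finset.mem_sdiff.1 (hEH hCE)).2
    set E' := E.erase C with hE'
    have hEins : E = insert C E' := (Finset.insert_erase hCE).symm
    have hE'H : E' ⊆ H := fun D hD => (Finset.mem_sdiff.1 (hEH (Finset.mem_of_mem_erase hD))).1
    have hset : upH C H \ upP C P = (H \ P).filter (fun D => ¬ D ⊆ C) := by
      ext D
      simp only [upH, upP, Finset.mem_sdiff, Finset.mem_filter, Finset.mem_insert]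
      constructor
      · rintro ⟨⟨a, b⟩, c⟩
        push Not at c
        have : ¬ D ⊆ C := fun hh => b (lt_of_le_of_ne hh c.1)
        exact ⟨⟨a, fun hh => this (c.2 hh)⟩, this⟩
      · rintro ⟨⟨a, b⟩, c⟩
        refine ⟨⟨a, fun hh => c hh.1⟩, ?_⟩
        rintro (rfl | hh)
        · exact c subset_rfl
        · exact b hh.1
    have hnE : ∀ D ∈ E', ¬ D ⊆ C := fun D hD hh =>
      hCmin' D (Finset.mem_of_mem_erase hD) (lt_of_le_of_ne hh (Finset.ne_of_mem_erase hD))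
    have step := count_mul h hCH hE'H (fun D hD => hCmin' D (Finset.mem_of_mem_erase hD))
    have ih' := ih E' X (upP C P) (upH C H) (by rw [Finset.card_erase_of_mem hCE]; omega)
      (h.up hCH) (by
        rw [hset]
        intro D hD
        exact Finset.mem_filter.2 ⟨hEH (Finset.mem_of_mem_erase hD), hnE D hD⟩)
      (fun hh => hXE (Finset.mem_of_mem_erase hh)) (by
        rw [upP, Finset.mem_insert, Finset.mem_filter]
        rintro (rfl | hh)
        · exact hXE hCE
        · exact hXP hh.1)
    have hl : (Finset.univ.filter (fun K => BinH X P K ∧ E ⊆ K)) =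
        (Finset.univ.filter (fun K => BinH X P K ∧ C ∈ K ∧ E' ⊆ K)) := by
      ext K
      rw [hEins]
      simp [Finset.insert_subset_iff]
    rw [hl, step, ih', (h.low hCH).count', ← Finset.mul_prod_erase E _ hCE, ← hE']
    have c1 : ((H \ P).filter (fun D => D ⊆ C ∧ ∀ C' ∈ E, C' ⊂ C → ¬ D ⊆ C')).card + 2 =
        (lowP C P).card + 1 := by
      rw [← (h.low hCH).card_int]
      have : lowH C H \ lowP C P =
          (H \ P).filter (fun D => D ⊆ C ∧ ∀ C' ∈ E, C' ⊂ C → ¬ D ⊆ C') := by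
        ext D
        simp only [lowH, lowP, Finset.mem_sdiff, Finset.mem_filter]
        constructor
        · rintro ⟨⟨a, b⟩, c⟩
          exact ⟨⟨a, fun hh => c ⟨hh, b⟩⟩, b, fun C' hC' hlt => absurd hlt (hCmin' C' hC')⟩
        · rintro ⟨⟨a, b⟩, c, _⟩
          exact ⟨⟨a, c⟩, fun hh => b hh.1⟩
      rw [this]
    have c2 : (H \ P).filter (fun D => ∀ C' ∈ E, ¬ D ⊆ C') =
        (upH C H \ upP C P).filter (fun D => ∀ C' ∈ E', ¬ D ⊆ C') := by
      rw [hset, Finset.filter_filter, hEins]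
      simp only [Finset.forall_mem_insert]
    have c3 : ∀ C2 ∈ E', (upH C H \ upP C P).filter (fun D => D ⊆ C2 ∧ ∀ C' ∈ E', C' ⊂ C2 → ¬ D ⊆ C') =
        (H \ P).filter (fun D => D ⊆ C2 ∧ ∀ C' ∈ E, C' ⊂ C2 → ¬ D ⊆ C') := by
      intro C2 hC2
      rw [hset, Finset.filter_filter]
      refine Finset.filter_congr fun D hD => ?_
      have hDH := (Finset.mem_sdiff.1 hD).1
      rw [hEins]
      simp only [Finset.forall_mem_insert]
      constructor
      · rintro ⟨a, b, c⟩
        exact ⟨b, fun _ => a, c⟩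
      · rintro ⟨a, b, c⟩
        refine ⟨fun hh => ?_, a, c⟩
        rcases h.lam hCH (hE'H hC2) with r | r | r
        · exact b (lt_of_le_of_ne r (Finset.ne_of_mem_erase hC2).symm) hh
        · exact hnE C2 hC2 r
        · exact notsub r (h.ne _ hDH) hh a
    rw [c1, c2, Finset.prod_congr rfl (fun C2 hC2 => by rw [c3 C2 hC2])]
    ring

end BinH

abbrev XX {n : ℕ} (z : Fin n) : Finset (Fin n) := Finset.univ.erase z
def PP {n : ℕ} (z : Fin n) : Finset (Finset (Fin n)) := (XX z).image (fun i => {i})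

theorem mem_PP {n : ℕ} {z : Fin n} {D : Finset (Fin n)} : D ∈ PP z ↔ ∃ i, i ≠ z ∧ {i} = D := by
  simp [PP, XX]

theorem card_PP {n : ℕ} (z : Fin n) : (PP z).card = n - 1 := by
  rw [PP, Finset.card_image_of_injective _ Finset.singleton_injective, XX,
    Finset.card_erase_of_mem (Finset.mem_univ _)]
  simp

structure Lab {n : ℕ} {V : Type} (G : SimpleGraph V) (leaf : Fin n → V) (z : Fin n)
    (c : V → Finset (Fin n)) (par : V → V) (H : Finset (Finset (Fin n))) : Prop where
  bin : BinH (XX z) (PP z) H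
  inj : Function.Injective c
  root : c (leaf z) = Finset.univ
  lf : ∀ i, i ≠ z → c (leaf i) = {i}
  mem : ∀ v, v ≠ leaf z → c v ∈ H
  surj : ∀ D ∈ H, ∃ v, c v = D
  plt : ∀ v, v ≠ leaf z → c v ⊂ c (par v)
  pmin : ∀ v, v ≠ leaf z → ∀ u, c v ⊂ c u → c (par v) ⊆ c u
  adj : ∀ u v, G.Adj u v ↔ (u ≠ leaf z ∧ par u = v) ∨ (v ≠ leaf z ∧ par v = u)

theorem reach_inv {V : Type} {G : SimpleGraph V} {Q : V → Prop}
    (hQ : ∀ a b, G.Adj a b → Q a → Q b) {a b : V} (h : G.Reachable a b) (ha : Q a) : Q b := by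
  obtain ⟨p⟩ := h
  induction p with
  | nil => exact ha
  | cons hadj _ ih => exact ih (hQ _ _ hadj ha)

namespace Lab

variable {n : ℕ} {V : Type} {G : SimpleGraph V} {leaf : Fin n → V} {z : Fin n}
    {c : V → Finset (Fin n)} {par : V → V} {H : Finset (Finset (Fin n))}

theorem znot (h : Lab G leaf z c par H) {D : Finset (Fin n)} (hD : D ∈ H) : z ∉ D := by
  intro hz
  simpa using h.bin.sub D hD hz

theorem ne_root (h : Lab G leaf z c par H) {v : V} (hv : c v ∈ H) : v ≠ leaf z := by
  rintro rfl
  apply h.znot hv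
  rw [h.root]; simp

theorem nonempty (h : Lab G leaf z c par H) (v : V) : (c v).Nonempty := by
  by_cases hv : v = leaf z
  · subst hv; rw [h.root]; exact ⟨z, by simp⟩
  · exact h.bin.ne _ (h.mem v hv)

theorem lam (h : Lab G leaf z c par H) (u v : V) : c u ⊆ c v ∨ c v ⊆ c u ∨ Disjoint (c u) (c v) := by
  by_cases hv : v = leaf z
  · subst hv; rw [h.root]; simp
  by_cases hu : u = leaf z
  · subst hu; rw [h.root]; simp
  exact h.bin.lam (h.mem u hu) (h.mem v hv)

theorem self_mem (h : Lab G leaf z c par H) (i : Fin n) : i ∈ c (leaf i) := by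
  by_cases hv : i = z
  · subst hv; rw [h.root]; simp
  · rw [h.lf i hv]; simp

theorem ssub (h : Lab G leaf z c par H) {u v : V} (hs : c u ⊆ c v) (hne : u ≠ v) : c u ⊂ c v :=
  lt_of_le_of_ne hs (fun e => hne (h.inj e))

theorem edge_inj (h : Lab G leaf z c par H) {u v : V} (hu : u ≠ leaf z) (hv : v ≠ leaf z)
    (he : s(u, par u) = s(v, par v)) : u = v := by
  rw [Sym2.eq_iff] at he
  rcases he with ⟨h1, _⟩ | ⟨h1, h2⟩
  · exact h1
  · exfalso
    have q1 := h.plt u hu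
    have q2 := h.plt v hv
    rw [h2] at q1
    rw [← h1] at q2
    exact q1.2 q2.1

theorem adj_par (h : Lab G leaf z c par H) {v : V} (hv : v ≠ leaf z) : G.Adj v (par v) :=
  (h.adj _ _).2 (Or.inl ⟨hv, rfl⟩)

theorem del_adj (h : Lab G leaf z c par H) {E : Set (Sym2 V)} {u v : V}
    (ha : (G.deleteEdges E).Adj u v) :
    (u ≠ leaf z ∧ par u = v ∧ s(u, par u) ∉ E) ∨ (v ≠ leaf z ∧ par v = u ∧ s(v, par v) ∉ E) := by
  rw [SimpleGraph.deleteEdges_adj, h.adj] at ha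
  obtain ⟨ha | ha, hE⟩ := ha
  · left; refine ⟨ha.1, ha.2, ?_⟩; rwa [ha.2]
  · right; refine ⟨ha.1, ha.2, ?_⟩; rwa [ha.2, Sym2.eq_swap]

theorem del_par (h : Lab G leaf z c par H) {E : Set (Sym2 V)} {v : V} (hv : v ≠ leaf z)
    (hE : s(v, par v) ∉ E) : (G.deleteEdges E).Adj v (par v) := by
  rw [SimpleGraph.deleteEdges_adj]
  exact ⟨h.adj_par hv, hE⟩

/-- climbing lemma -/
theorem climb (h : Lab G leaf z c par H) (E : Set (Sym2 V)) (Q : V → Prop) (w : V)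
    (hQ : ∀ v, Q v → v ≠ w → v ≠ leaf z ∧ s(v, par v) ∉ E ∧ Q (par v)) :
    ∀ v, Q v → (G.deleteEdges E).Reachable v w := by
  suffices ∀ k : ℕ, ∀ v, n - (c v).card = k → Q v → (G.deleteEdges E).Reachable v w from
    fun v => this _ v rfl
  intro k
  induction k using Nat.strong_induction_on with
  | _ k ih =>
    intro v hk hv
    by_cases hvw : v = w
    · subst hvw; rfl
    obtain ⟨h1, h2, h3⟩ := hQ v hv hvw
    have hlt := Finset.card_lt_card (h.plt v h1)
    have hle : (c (par v)).card ≤ n := by simpa using Finset.card_le_univ (c (par v))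
    exact (h.del_par h1 h2).reachable.trans (ih _ (by omega) (par v) rfl h3)

def sig {n : ℕ} (D : Finset (Fin n)) : Sym2 (Finset (Fin n)) := s(D, Dᶜ)

theorem split_edge [Fintype V] (h : Lab G leaf z c par H) {v : V} (hv : v ≠ leaf z) :
    splitOfEdge n G leaf s(v, par v) = sig (c v) := by
  have hz : z ∉ c v := h.znot (h.mem v hv)
  set E : Set (Sym2 V) := {s(v, par v)} with hE
  have hnE : ∀ u, u ≠ leaf z → u ≠ v → s(u, par u) ∉ E := fun u hu huv hh =>
    huv (h.edge_inj hu hv hh)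
  have inv : ∀ a b, (G.deleteEdges E).Adj a b → c a ⊆ c v → c b ⊆ c v := by
    intro a b hab ha
    rcases h.del_adj hab with ⟨h1, h2, h3⟩ | ⟨h1, h2, h3⟩
    · have hav : a ≠ v := by rintro rfl; exact h3 rfl
      rw [← h2]
      exact h.pmin a h1 v (h.ssub ha hav)
    · have := h.plt b h1
      rw [h2] at this
      exact this.1.trans ha
  have up1 : ∀ u, c u ⊆ c v → (G.deleteEdges E).Reachable u v := by
    refine h.climb E (fun u => c u ⊆ c v) v ?_
    intro u hu huv
    have hur : u ≠ leaf z := by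
      rintro rfl
      rw [h.root] at hu
      exact hz (hu (Finset.mem_univ _))
    exact ⟨hur, hnE u hur huv, h.pmin u hur v (h.ssub hu huv)⟩
  have up2 : ∀ u, ¬ c u ⊆ c v → (G.deleteEdges E).Reachable u (leaf z) := by
    refine h.climb E (fun u => ¬ c u ⊆ c v) (leaf z) ?_
    intro u hu hur
    refine ⟨hur, hnE u hur ?_, fun hh => hu ((h.plt u hur).1.trans hh)⟩
    rintro rfl
    exact hu subset_rfl
  have hpar : ¬ c (par v) ⊆ c v := (h.plt v hv).2
  have hsub : ∀ i, c (leaf i) ⊆ c v ↔ i ∈ c v := by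
    intro i
    constructor
    · intro hh; exact hh (h.self_mem i)
    · intro hi
      have : i ≠ z := by rintro rfl; exact hz hi
      rw [h.lf i this]
      simpa using hi
  have e1 : ∀ i, (G.deleteEdges E).Reachable (leaf i) v ↔ i ∈ c v := by
    intro i
    rw [← hsub]
    constructor
    · intro hr
      exact reach_inv inv hr.symm subset_rfl
    · intro hi
      exact up1 _ hi
  have e2 : ∀ i, (G.deleteEdges E).Reachable (leaf i) (par v) ↔ i ∉ c v := by
    intro i
    constructor
    · intro hr hi
      rw [← hsub] at hi
      exact hpar (reach_inv inv hr hi)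
    · intro hi
      rw [← hsub] at hi
      exact (up2 _ hi).trans (up2 _ hpar).symm
  unfold splitOfEdge sig
  rw [Sym2.map_mk]
  have q1 : (Finset.univ.filter fun i => (G.deleteEdges {s(v, par v)}).Reachable (leaf i) v) = c v := by
    ext i; simpa using e1 i
  have q2 : (Finset.univ.filter fun i => (G.deleteEdges {s(v, par v)}).Reachable (leaf i) (par v)) =
      (c v)ᶜ := by
    ext i; simpa using e2 i
  rw [q1, q2]

theorem edge_exists (h : Lab G leaf z c par H) {e : Sym2 V} (he : e ∈ G.edgeSet) :
    ∃ v, v ≠ leaf z ∧ s(v, par v) = e := by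
  induction e with
  | _ a b =>
    rw [SimpleGraph.mem_edgeSet, h.adj] at he
    rcases he with ⟨h1, h2⟩ | ⟨h1, h2⟩
    · exact ⟨a, h1, by rw [h2]⟩
    · exact ⟨b, h1, by rw [h2, Sym2.eq_swap]⟩

theorem splits [Fintype V] (h : Lab G leaf z c par H) : splitsOf n G leaf = H.image sig := by
  ext σ
  simp only [splitsOf, Finset.mem_image, SimpleGraph.mem_edgeFinset]
  constructor
  · rintro ⟨e, he, rfl⟩
    obtain ⟨v, hv, rfl⟩ := h.edge_exists he
    exact ⟨c v, h.mem v hv, (h.split_edge hv).symm⟩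
  · rintro ⟨D, hD, rfl⟩
    obtain ⟨v, rfl⟩ := h.surj D hD
    exact ⟨s(v, par v), h.adj_par (h.ne_root hD), h.split_edge (h.ne_root hD)⟩

/-- internal non-top vertices -/
def intV [Fintype V] (z : Fin n) (c : V → Finset (Fin n)) (H : Finset (Finset (Fin n))) : Finset V :=
  Finset.univ.filter (fun v => c v ∈ (H \ PP z).erase (XX z))

theorem leaf_iff (h : Lab G leaf z c par H) (v : V) : v ∈ Set.range leaf ↔ v = leaf z ∨ c v ∈ PP z := by
  constructor
  · rintro ⟨i, rfl⟩
    by_cases hi : i = z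
    · left; rw [hi]
    · right; rw [h.lf i hi]; exact mem_PP.2 ⟨i, hi, rfl⟩
  · rintro (rfl | hv)
    · exact ⟨z, rfl⟩
    · obtain ⟨i, hi, h2⟩ := mem_PP.1 hv
      refine ⟨i, h.inj ?_⟩
      rw [h.lf i hi, h2]

theorem par_root (h : Lab G leaf z c par H) (v : V) (hv : v ≠ leaf z) : par v = leaf z ↔ c v = XX z := by
  constructor
  · intro hp
    by_contra hne
    obtain ⟨t, ht⟩ := h.surj _ h.bin.top
    have hlt : c v ⊂ c t := by
      rw [ht]; exact lt_of_le_of_ne (h.bin.sub _ (h.mem v hv)) hne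
    have := h.pmin v hv t hlt
    rw [hp, h.root, ht] at this
    simpa using this (Finset.mem_univ z)
  · intro hv2
    by_contra hne
    have h1 := h.plt v hv
    have h2 := h.bin.sub _ (h.mem _ hne)
    rw [hv2] at h1
    exact h1.2 h2

theorem internal [Fintype V] (h : Lab G leaf z c par H) :
    internalEdgesG n G leaf = (intV z c H).image (fun v => s(v, par v)) := by
  ext e
  simp only [internalEdgesG, Finset.mem_filter, Finset.mem_image, SimpleGraph.mem_edgeFinset, intV,
    Finset.mem_univ, true_and, Finset.mem_erase, Finset.mem_sdiff]
  constructor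
  · rintro ⟨he, hl⟩
    obtain ⟨v, hv, rfl⟩ := h.edge_exists he
    have h1 := hl v (by simp)
    have h2 := hl (par v) (by simp)
    rw [h.leaf_iff] at h1 h2
    push Not at h1 h2
    exact ⟨v, ⟨fun hh => h2.1 ((h.par_root v hv).2 hh), h.mem v hv, h1.2⟩, rfl⟩
  · rintro ⟨v, ⟨h1, h2, h3⟩, rfl⟩
    have hv := h.ne_root h2
    refine ⟨h.adj_par hv, ?_⟩
    intro u hu
    rw [h.leaf_iff]
    rcases Sym2.mem_iff.1 hu with rfl | rfl
    · push Not; exact ⟨hv, h3⟩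
    · push Not
      refine ⟨fun hh => h1 ((h.par_root v hv).1 hh), fun hh => ?_⟩
      have := h.plt v hv
      exact this.ne (h.bin.mn _ hh _ h2 this.1)

end Lab

namespace Lab

variable {n : ℕ} {V : Type} {G : SimpleGraph V} {leaf : Fin n → V} {z : Fin n}
    {c : V → Finset (Fin n)} {par : V → V} {H : Finset (Finset (Fin n))}

def QQ (c : V → Finset (Fin n)) (W : Finset V) (w v : V) : Prop :=
  c v ⊆ c w ∧ ∀ w' ∈ W, c w' ⊂ c w → ¬ c v ⊆ c w'

theorem mem_intV [Fintype V] {v : V} : v ∈ intV z c H ↔ c v ≠ XX z ∧ c v ∈ H ∧ c v ∉ PP z := by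
  simp only [intV, Finset.mem_filter, Finset.mem_univ, true_and, Finset.mem_erase, Finset.mem_sdiff]

theorem eps_mem [Fintype V] (h : Lab G leaf z c par H) {W : Finset V} (hW : W ⊆ intV z c H) {v : V}
    (hv : v ≠ leaf z) : s(v, par v) ∈ W.image (fun v => s(v, par v)) ↔ v ∈ W := by
  rw [Finset.mem_image]
  constructor
  · rintro ⟨u, hu, he⟩
    have := h.edge_inj (h.ne_root (mem_intV.1 (hW hu)).2.1) hv he
    rwa [← this]
  · intro hv
    exact ⟨v, hv, rfl⟩

theorem mk_iff [Fintype V] (h : Lab G leaf z c par H) {W : Finset V} (hW : W ⊆ intV z c H) {v w : V}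
    (hw : w ∈ insert (leaf z) W) :
    (G.deleteEdges ((W.image (fun v => s(v, par v)) : Finset (Sym2 V)) : Set (Sym2 V))).connectedComponentMk v =
    (G.deleteEdges ((W.image (fun v => s(v, par v)) : Finset (Sym2 V)) : Set (Sym2 V))).connectedComponentMk w
    ↔ QQ c W w v := by
  rw [SimpleGraph.ConnectedComponent.eq]
  constructor
  · intro hr
    refine reach_inv (Q := QQ c W w) ?_ hr.symm ⟨subset_rfl, fun w' _ hlt => hlt.2⟩
    intro a b hab ha
    rcases h.del_adj hab with ⟨h1, h2, h3⟩ | ⟨h1, h2, h3⟩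
    · rw [Finset.mem_coe, h.eps_mem hW h1] at h3
      have haw : a ≠ w := by
        rintro rfl
        rcases Finset.mem_insert.1 hw with r | r
        · exact h1 r
        · exact h3 r
      rw [← h2]
      refine ⟨h.pmin a h1 w (h.ssub ha.1 haw), fun w' hw' hlt hs => ?_⟩
      exact ha.2 w' hw' hlt ((h.plt a h1).1.trans hs)
    · rw [Finset.mem_coe, h.eps_mem hW h1] at h3
      have hlt := h.plt b h1
      rw [h2] at hlt
      refine ⟨hlt.1.trans ha.1, fun w' hw' hlt' hs => ?_⟩
      have hbw : b ≠ w' := by rintro rfl; exact h3 hw'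
      have := h.pmin b h1 w' (h.ssub hs hbw)
      rw [h2] at this
      exact ha.2 w' hw' hlt' this
  · refine h.climb _ (QQ c W w) w ?_ v
    intro v hv hvw
    have hlt := h.ssub hv.1 hvw
    have hvr : v ≠ leaf z := by
      rintro rfl
      rw [h.root] at hlt
      exact hlt.2 (Finset.subset_univ _)
    have hvW : v ∉ W := fun hh => hv.2 v hh hlt subset_rfl
    refine ⟨hvr, ?_, h.pmin v hvr w hlt, fun w' hw' hlt' hs => ?_⟩
    · rwa [Finset.mem_coe, h.eps_mem hW hvr]
    · exact hv.2 w' hw' hlt' ((h.plt v hvr).1.trans hs)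

theorem Q_exists [Fintype V] (h : Lab G leaf z c par H) (W : Finset V) (v : V) :
    ∃ w ∈ insert (leaf z) W, QQ c W w v := by
  have hne : ((insert (leaf z) W).filter (fun w => c v ⊆ c w)).Nonempty :=
    ⟨leaf z, Finset.mem_filter.2 ⟨Finset.mem_insert_self _ _, by rw [h.root]; simp⟩⟩
  obtain ⟨w, hw, hmin⟩ := Finset.exists_min_image _ (fun w => (c w).card) hne
  rw [Finset.mem_filter] at hw
  refine ⟨w, hw.1, hw.2, fun w' hw' hlt hs => ?_⟩
  have := hmin w' (Finset.mem_filter.2 ⟨Finset.mem_insert_of_mem hw', hs⟩)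
  have := Finset.card_lt_card hlt
  omega

theorem card_conv [Fintype V] (h : Lab G leaf z c par H) (R : Finset (Fin n) → Prop) [DecidablePred R] :
    ((H \ PP z).filter R).card =
    (Finset.univ.filter (fun v => c v ∈ H \ PP z ∧ R (c v))).card := by
  rw [← Finset.card_image_of_injective _ h.inj]
  congr 1
  ext D
  simp only [Finset.mem_filter, Finset.mem_image, Finset.mem_univ, true_and]
  constructor
  · rintro ⟨h1, h2⟩
    obtain ⟨v, rfl⟩ := h.surj D (Finset.mem_sdiff.1 h1).1
    exact ⟨v, ⟨h1, h2⟩, rfl⟩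
  · rintro ⟨v, ⟨h1, h2⟩, rfl⟩
    exact ⟨h1, h2⟩

theorem NE [Fintype V] (hn : 3 ≤ n) (h : Lab G leaf z c par H) {W : Finset V} (hW : W ⊆ intV z c H) :
    NEdges n G leaf (W.image (fun v => s(v, par v))) =
    (Finset.univ.filter (fun K => BinH (XX z) (PP z) K ∧ W.image c ⊆ K)).card := by
  have hXP : XX z ∉ PP z := by
    intro hh
    obtain ⟨i, hi, he⟩ := mem_PP.1 hh
    have := congrArg Finset.card he
    rw [Finset.card_singleton, XX, Finset.card_erase_of_mem (Finset.mem_univ _)] at this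
    simp at this
    omega
  have hWr : leaf z ∉ W := fun hh => h.ne_root (mem_intV.1 (hW hh)).2.1 rfl
  have hinj : Set.InjOn (fun v => s(v, par v)) (intV z c H : Set V) := by
    intro u hu v hv he
    exact h.edge_inj (h.ne_root (mem_intV.1 hu).2.1) (h.ne_root (mem_intV.1 hv).2.1) he
  rw [BinH.count_prod W.card (W.image c) (XX z) (PP z) H (Finset.card_image_of_injective _ h.inj)
    h.bin ?_ ?_ hXP]
  rotate_left
  · intro D hD
    obtain ⟨v, hv, rfl⟩ := Finset.mem_image.1 hD
    exact Finset.mem_sdiff.2 (mem_intV.1 (hW hv)).2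
  · intro hD
    obtain ⟨v, hv, he⟩ := Finset.mem_image.1 hD
    exact (mem_intV.1 (hW hv)).1 he
  rw [Finset.prod_image (fun a _ b _ e => h.inj e)]
  unfold NEdges
  set E := W.image (fun v => s(v, par v)) with hE
  have himg : Finset.univ.image (G.deleteEdges (E : Set (Sym2 V))).connectedComponentMk =
      (insert (leaf z) W).image (G.deleteEdges (E : Set (Sym2 V))).connectedComponentMk := by
    ext C
    simp only [Finset.mem_image, Finset.mem_univ, true_and]
    constructor
    · rintro ⟨v, rfl⟩
      obtain ⟨w, hw, hq⟩ := h.Q_exists W v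
      exact ⟨w, hw, ((h.mk_iff hW hw).2 hq).symm⟩
    · rintro ⟨v, _, rfl⟩
      exact ⟨v, rfl⟩
  have hmkinj : Set.InjOn (G.deleteEdges (E : Set (Sym2 V))).connectedComponentMk
      ((insert (leaf z) W : Finset V) : Set V) := by
    intro u hu v hv he
    have h1 := (h.mk_iff hW hv).1 he
    have h2 := (h.mk_iff hW hu).1 he.symm
    exact h.inj (h1.1.antisymm h2.1)
  rw [himg, Finset.prod_image hmkinj, Finset.prod_insert hWr]
  have hcard : ∀ w ∈ insert (leaf z) W, (((internalEdgesG n G leaf) \ E).filter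
      (fun e => ∀ v ∈ e, (G.deleteEdges (E : Set (Sym2 V))).connectedComponentMk v =
        (G.deleteEdges (E : Set (Sym2 V))).connectedComponentMk w)).card =
      ((intV z c H \ W).filter (fun v => QQ c W w v)).card := by
    intro w hw
    rw [← Finset.card_image_of_injOn (s := (intV z c H \ W).filter (fun v => QQ c W w v))
      (hinj.mono ?_)]
    · congr 1
      ext e
      rw [h.internal]
      simp only [Finset.mem_filter, Finset.mem_sdiff, Finset.mem_image]
      constructor
      · rintro ⟨⟨⟨v, hv, rfl⟩, h2⟩, h3⟩
        refine ⟨v, ⟨⟨hv, fun hh => h2 (Finset.mem_image.2 ⟨v, hh, rfl⟩)⟩, ?_⟩, rfl⟩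
        rw [← h.mk_iff hW hw]
        exact h3 v (by simp)
      · rintro ⟨v, ⟨⟨hv, hvW⟩, h2⟩, rfl⟩
        have hvr := h.ne_root (mem_intV.1 hv).2.1
        have hvE : s(v, par v) ∉ E := by rwa [hE, h.eps_mem hW hvr]
        refine ⟨⟨⟨v, hv, rfl⟩, hvE⟩, ?_⟩
        rw [← h.mk_iff hW hw] at h2
        intro u hu
        rcases Sym2.mem_iff.1 hu with rfl | rfl
        · exact h2
        · rw [← h2, SimpleGraph.ConnectedComponent.eq]
          exact (h.del_par hvr hvE).reachable.symm
    · intro v hv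
      have := (Finset.mem_filter.1 (Finset.mem_coe.1 hv)).1
      exact Finset.mem_coe.2 (Finset.mem_sdiff.1 this).1
  congr 1
  · rw [hcard _ (Finset.mem_insert_self _ _)]
    congr 1
    obtain ⟨t, ht⟩ := h.surj _ h.bin.top
    have : (Finset.univ.filter (fun v => c v ∈ H \ PP z ∧ ∀ C' ∈ W.image c, ¬ c v ⊆ C')) =
        insert t ((intV z c H \ W).filter (fun v => QQ c W (leaf z) v)) := by
      ext v
      simp only [Finset.mem_filter, Finset.mem_univ, true_and, Finset.mem_insert, Finset.mem_sdiff,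
        mem_intV, Finset.forall_mem_image]
      simp only [QQ, h.root, Finset.subset_univ, true_and]
      constructor
      · rintro ⟨⟨a, b⟩, d⟩
        by_cases hvt : v = t
        · exact Or.inl hvt
        · refine Or.inr ⟨⟨⟨fun hh => hvt (h.inj (hh.trans ht.symm)), a, b⟩, fun hh => d hh subset_rfl⟩,
            fun w hw _ => d hw⟩
      · rintro (rfl | ⟨⟨⟨a, b, d⟩, e⟩, f⟩)
        · rw [ht]
          refine ⟨⟨h.bin.top, hXP⟩, fun w hw hs => ?_⟩
          have := mem_intV.1 (hW hw)
          exact this.1 ((h.bin.sub _ this.2.1).antisymm hs)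
        · refine ⟨⟨b, d⟩, fun w hw => f w hw ?_⟩
          have := mem_intV.1 (hW hw)
          have hz := h.znot this.2.1
          refine ⟨Finset.subset_univ _, fun hh => hz (hh (Finset.mem_univ _))⟩
    rw [h.card_conv, this, Finset.card_insert_of_notMem]
    intro hh
    simp only [Finset.mem_filter, Finset.mem_sdiff, mem_intV] at hh
    exact hh.1.1.1 ht
  · refine Finset.prod_congr rfl fun w hw => ?_
    rw [hcard _ (Finset.mem_insert_of_mem hw)]
    congr 1
    have : (Finset.univ.filter (fun v => c v ∈ H \ PP z ∧ c v ⊆ c w ∧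
          ∀ C' ∈ W.image c, C' ⊂ c w → ¬ c v ⊆ C')) =
        insert w ((intV z c H \ W).filter (fun v => QQ c W w v)) := by
      ext v
      simp only [Finset.mem_filter, Finset.mem_univ, true_and, Finset.mem_insert, Finset.mem_sdiff,
        mem_intV, Finset.forall_mem_image]
      simp only [QQ]
      have hwI := mem_intV.1 (hW hw)
      constructor
      · rintro ⟨⟨a, b⟩, d, e⟩
        by_cases hvw : v = w
        · exact Or.inl hvw
        · have hlt := h.ssub d hvw
          refine Or.inr ⟨⟨⟨fun hh => ?_, a, b⟩, fun hh => e hh hlt subset_rfl⟩, d, e⟩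
          rw [hh] at hlt
          exact hlt.2 (h.bin.sub _ hwI.2.1)
      · rintro (rfl | ⟨⟨⟨a, b, d⟩, e⟩, f⟩)
        · exact ⟨hwI.2, subset_rfl, fun w' _ hlt => hlt.2⟩
        · exact ⟨⟨b, d⟩, f⟩
    rw [h.card_conv, this, Finset.card_insert_of_notMem]
    intro hh
    simp only [Finset.mem_filter, Finset.mem_sdiff] at hh
    exact hh.1.2 hw

theorem rC [Fintype V] (hn : 3 ≤ n) (h : Lab G leaf z c par H) (s : ℕ) :
    rCoeff n G leaf s = ∑ W ∈ ((H \ PP z).erase (XX z)).powersetCard s,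
      (Finset.univ.filter (fun K => BinH (XX z) (PP z) K ∧ W ⊆ K)).card := by
  have hinj : Set.InjOn (fun v => s(v, par v)) (intV z c H : Set V) := by
    intro u hu v hv he
    exact h.edge_inj (h.ne_root (mem_intV.1 hu).2.1) (h.ne_root (mem_intV.1 hv).2.1) he
  have e1 : rCoeff n G leaf s = ∑ W ∈ (intV z c H).powersetCard s,
      (Finset.univ.filter (fun K => BinH (XX z) (PP z) K ∧ W.image c ⊆ K)).card := by
    unfold rCoeff
    symm
    refine Finset.sum_bij (fun W _ => W.image (fun v => s(v, par v))) ?_ ?_ ?_ ?_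
    · intro W hW
      rw [Finset.mem_powersetCard] at hW
      rw [Finset.mem_filter, Finset.mem_powerset, h.internal]
      refine ⟨Finset.image_subset_image hW.1, ?_⟩
      rw [Finset.card_image_of_injOn (hinj.mono hW.1), hW.2]
    · intro W hW W' hW' he
      rw [Finset.mem_powersetCard] at hW hW'
      ext v
      constructor
      · intro hv
        rw [← h.eps_mem hW'.1 (h.ne_root (mem_intV.1 (hW.1 hv)).2.1), ← he]
        exact Finset.mem_image.2 ⟨v, hv, rfl⟩
      · intro hv
        rw [← h.eps_mem hW.1 (h.ne_root (mem_intV.1 (hW'.1 hv)).2.1), he]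
        exact Finset.mem_image.2 ⟨v, hv, rfl⟩
    · intro E hE
      rw [Finset.mem_filter, Finset.mem_powerset, h.internal] at hE
      obtain ⟨W, hW, rfl⟩ := Finset.subset_image_iff.1 hE.1
      have hW' : W ⊆ intV z c H := by exact_mod_cast hW
      refine ⟨W, Finset.mem_powersetCard.2 ⟨hW', ?_⟩, rfl⟩
      rw [← Finset.card_image_of_injOn (hinj.mono hW), hE.2]
    · intro W hW
      rw [Finset.mem_powersetCard] at hW
      exact (h.NE hn hW.1).symm
  rw [e1]
  refine Finset.sum_bij (fun W _ => W.image c) ?_ ?_ ?_ ?_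
  · intro W hW
    rw [Finset.mem_powersetCard] at hW ⊢
    refine ⟨?_, by rw [Finset.card_image_of_injective _ h.inj, hW.2]⟩
    intro D hD
    obtain ⟨v, hv, rfl⟩ := Finset.mem_image.1 hD
    exact (Finset.mem_filter.1 (hW.1 hv)).2
  · intro W _ W' _ he
    exact Finset.image_injective h.inj he
  · intro E hE
    rw [Finset.mem_powersetCard] at hE
    have : E ⊆ (intV z c H).image c := by
      intro D hD
      have hD' := hE.1 hD
      obtain ⟨v, rfl⟩ := h.surj D (Finset.mem_sdiff.1 (Finset.mem_of_mem_erase hD')).1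
      exact Finset.mem_image.2 ⟨v, Finset.mem_filter.2 ⟨Finset.mem_univ _, hD'⟩, rfl⟩
    obtain ⟨W, hW, rfl⟩ := Finset.subset_image_iff.1 this
    refine ⟨W, Finset.mem_powersetCard.2 ⟨by exact_mod_cast hW, ?_⟩, rfl⟩
    rw [← hE.2, Finset.card_image_of_injective _ h.inj]
  · intro W hW
    rfl

end Lab

theorem degree_eq_of {V : Type} [Fintype V] (G : SimpleGraph V) (v : V) (S : Finset V)
    (hS : ∀ w, G.Adj v w ↔ w ∈ S) : G.degree v = S.card := by
  rw [← SimpleGraph.card_neighborFinset_eq_degree]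
  congr 1
  ext w
  rw [SimpleGraph.mem_neighborFinset, hS]

namespace Lab

variable {n : ℕ} {V : Type} {G : SimpleGraph V} {leaf : Fin n → V} {z : Fin n}
    {c : V → Finset (Fin n)} {par : V → V} {H : Finset (Finset (Fin n))}

theorem isTree [Fintype V] (h : Lab G leaf z c par H) : G.IsTree := by
  rw [SimpleGraph.isTree_iff_connected_and_card]
  constructor
  · have : ∀ v, G.Reachable v (leaf z) := by
      intro v
      have := h.climb ∅ (fun _ => True) (leaf z) (fun v _ hv => ⟨hv, by simp, trivial⟩) v trivial
      simpa using this
    have hne : Nonempty V := ⟨leaf z⟩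
    exact SimpleGraph.Connected.mk (fun u v => (this u).trans (this v).symm)
  · have e : Nat.card G.edgeSet = ((Finset.univ : Finset V).erase (leaf z)).card := by
      rw [← Fintype.card_coe, ← Nat.card_eq_fintype_card]
      symm
      refine Nat.card_congr (Equiv.ofBijective
        (fun v => ⟨s(v.1, par v.1), h.adj_par (Finset.ne_of_mem_erase v.2)⟩) ⟨?_, ?_⟩)
      · rintro ⟨u, hu⟩ ⟨v, hv⟩ he
        have := h.edge_inj (Finset.ne_of_mem_erase hu) (Finset.ne_of_mem_erase hv)
          (congrArg Subtype.val he)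
        exact Subtype.ext this
      · rintro ⟨e, he⟩
        obtain ⟨v, hv, rfl⟩ := h.edge_exists he
        exact ⟨⟨v, by simp [hv]⟩, rfl⟩
    rw [e, Finset.card_erase_add_one (Finset.mem_univ _)]
    simp

theorem phylo [Fintype V] (h : Lab G leaf z c par H) : IsBinaryPhylo n G leaf := by
  refine ⟨h.isTree, ?_, ?_, ?_⟩
  · intro i j hij
    have hi := h.self_mem i
    have hj := h.self_mem j
    by_cases h1 : i = z
    · by_cases h2 : j = z
      · rw [h1, h2]
      · rw [hij, h.lf j h2] at hi
        simpa using hi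
    · rw [← hij, h.lf i h1] at hj
      simp at hj
      exact hj.symm
  · intro i
    by_cases hi : i = z
    · subst hi
      obtain ⟨t, ht⟩ := h.surj _ h.bin.top
      have htr : t ≠ leaf i := h.ne_root (by rw [ht]; exact h.bin.top)
      rw [degree_eq_of G _ {t}]
      · simp
      intro w
      rw [h.adj, Finset.mem_singleton]
      constructor
      · rintro (⟨h1, h2⟩ | ⟨h1, h2⟩)
        · exact absurd rfl h1
        · rw [h.par_root w h1] at h2
          exact h.inj (h2.trans ht.symm)
      · rintro rfl
        exact Or.inr ⟨htr, (h.par_root w htr).2 ht⟩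
    · have hir : leaf i ≠ leaf z := by
        intro hh
        have h1 := h.self_mem z
        rw [← hh, h.lf i hi] at h1
        simp at h1
        exact hi h1.symm
      rw [degree_eq_of G _ {par (leaf i)}]
      · simp
      intro w
      rw [h.adj, Finset.mem_singleton]
      constructor
      · rintro (⟨h1, h2⟩ | ⟨h1, h2⟩)
        · exact h2.symm
        · exfalso
          have h3 := h.plt w h1
          rw [h2] at h3
          have h4 : {i} ∈ PP z := mem_PP.2 ⟨i, hi, rfl⟩
          rw [h.lf i hi] at h3
          exact h3.ne (h.bin.mn _ h4 _ (h.mem w h1) h3.1)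
      · rintro rfl
        exact Or.inl ⟨hir, rfl⟩
  · intro v hv
    rw [h.leaf_iff] at hv
    push Not at hv
    obtain ⟨A, hA, B, hB, hAB, hABE, sA, sB, hs⟩ := h.bin.nd' (h.mem v hv.1) hv.2
    obtain ⟨a, rfl⟩ := h.surj A hA
    obtain ⟨b, rfl⟩ := h.surj B hB
    have har := h.ne_root hA
    have hbr := h.ne_root hB
    have key : ∀ a b, a ≠ leaf z → Disjoint (c a) (c b) → c a ⊂ c v →
        (∀ D' ∈ H, D' ⊂ c v → D' ⊆ c a ∨ D' ⊆ c b) → par a = v := by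
      intro a b har hAB sA hs
      by_contra hne
      have h1 := h.pmin a har v sA
      have h2 := h.ssub h1 hne
      have h3 := h.plt a har
      have h4 : par a ≠ leaf z := by
        intro hh
        rw [hh, h.root] at h2
        exact h2.2 (Finset.subset_univ _)
      rcases hs _ (h.mem _ h4) h2 with r | r
      · exact h3.2 r
      · exact BinH.notsub hAB (h.nonempty a) subset_rfl (h3.1.trans r)
    have ka := key a b har hAB sA hs
    have kb := key b a hbr hAB.symm sB (fun D' x y => (hs D' x y).symm)
    rw [degree_eq_of G _ {par v, a, b}]
    · have hab : a ≠ b := by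
        rintro rfl
        exact BinH.notsub hAB (h.nonempty a) subset_rfl subset_rfl
      have hpv := h.plt v hv.1
      rw [Finset.card_insert_of_notMem, Finset.card_pair hab]
      simp only [Finset.mem_insert, Finset.mem_singleton]
      rintro (r | r)
      · rw [r] at hpv; exact hpv.2 sA.1
      · rw [r] at hpv; exact hpv.2 sB.1
    intro w
    rw [h.adj]
    simp only [Finset.mem_insert, Finset.mem_singleton]
    constructor
    · rintro (⟨h1, h2⟩ | ⟨h1, h2⟩)
      · exact Or.inl h2.symm
      · right
        have hlt := h.plt w h1
        rw [h2] at hlt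
        rcases hs _ (h.mem w h1) hlt with r | r
        · left
          by_contra hne
          have := h.pmin w h1 a (h.ssub r hne)
          rw [h2] at this
          exact sA.2 this
        · right
          by_contra hne
          have := h.pmin w h1 b (h.ssub r hne)
          rw [h2] at this
          exact sB.2 this
    · rintro (rfl | rfl | rfl)
      · exact Or.inl ⟨hv.1, rfl⟩
      · exact Or.inr ⟨har, ka⟩
      · exact Or.inr ⟨hbr, kb⟩

end Lab

theorem exists_lab {n : ℕ} (hn : 3 ≤ n) (z : Fin n) {H : Finset (Finset (Fin n))}
    (hH : BinH (XX z) (PP z) H) :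
    ∃ (G : SimpleGraph (Fin n ⊕ Fin (n - 2))) (c : Fin n ⊕ Fin (n - 2) → Finset (Fin n))
      (par : Fin n ⊕ Fin (n - 2) → Fin n ⊕ Fin (n - 2)), Lab G Sum.inl z c par H := by
  have hz : ∀ D ∈ H, z ∉ D := fun D hD hh => by simpa using hH.sub D hD hh
  have hcard : (H \ PP z).card = n - 2 := by
    have := hH.card_int
    rw [card_PP] at this
    omega
  let e : Fin (n - 2) ≃ (H \ PP z : Finset (Finset (Fin n))) :=
    (finCongr hcard.symm).trans (H \ PP z).equivFin.symm
  let c : Fin n ⊕ Fin (n - 2) → Finset (Fin n) :=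
    Sum.elim (fun i => if i = z then Finset.univ else {i}) (fun j => (e j).1)
  have cr : c (Sum.inl z) = Finset.univ := by simp [c]
  have cl : ∀ i, i ≠ z → c (Sum.inl i) = {i} := fun i hi => by simp [c, hi]
  have cm : ∀ v, v ≠ Sum.inl z → c v ∈ H := by
    rintro (i | j) hv
    · have hi : i ≠ z := fun hh => hv (by rw [hh])
      rw [cl i hi]
      exact hH.atm (mem_PP.2 ⟨i, hi, rfl⟩)
    · exact (Finset.mem_sdiff.1 (e j).2).1
  have cP : ∀ j, c (Sum.inr j) ∉ PP z := fun j => (Finset.mem_sdiff.1 (e j).2).2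
  have cinj' : ∀ u v, u ≠ Sum.inl z → v ≠ Sum.inl z → c u = c v → u = v := by
    rintro (i | j) (i' | j') hu hv he
    · have hi : i ≠ z := fun hh => hu (by rw [hh])
      have hi' : i' ≠ z := fun hh => hv (by rw [hh])
      rw [cl i hi, cl i' hi'] at he
      rw [Finset.singleton_injective he]
    · have hi : i ≠ z := fun hh => hu (by rw [hh])
      rw [cl i hi] at he
      exact absurd (mem_PP.2 ⟨i, hi, he⟩) (cP j')
    · have hi' : i' ≠ z := fun hh => hv (by rw [hh])
      rw [cl i' hi'] at he
      exact absurd (mem_PP.2 ⟨i', hi', he.symm⟩) (cP j)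
    · have : e j = e j' := Subtype.ext he
      rw [e.injective this]
  have cinj : Function.Injective c := by
    intro u v he
    by_cases hu : u = Sum.inl z <;> by_cases hv : v = Sum.inl z
    · rw [hu, hv]
    · exfalso
      apply hz _ (cm v hv)
      rw [← he, hu, cr]; simp
    · exfalso
      apply hz _ (cm u hu)
      rw [he, hv, cr]; simp
    · exact cinj' u v hu hv he
  have lam : ∀ u v, c u ⊆ c v ∨ c v ⊆ c u ∨ Disjoint (c u) (c v) := by
    intro u v
    by_cases hv : v = Sum.inl z
    · subst hv; rw [cr]; simp
    by_cases hu : u = Sum.inl z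
    · subst hu; rw [cr]; simp
    exact hH.lam (cm u hu) (cm v hv)
  have hpar : ∀ v, ∃ p, v ≠ Sum.inl z → (c v ⊂ c p ∧ ∀ u, c v ⊂ c u → c p ⊆ c u) := by
    intro v
    by_cases hv : v = Sum.inl z
    · exact ⟨v, fun hh => absurd hv hh⟩
    have hne : (Finset.univ.filter (fun u => c v ⊂ c u)).Nonempty := by
      refine ⟨Sum.inl z, Finset.mem_filter.2 ⟨Finset.mem_univ _, ?_⟩⟩
      rw [cr]
      exact ⟨Finset.subset_univ _, fun hh => hz _ (cm v hv) (hh (Finset.mem_univ _))⟩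
    obtain ⟨p, hp, hmin⟩ := Finset.exists_min_image _ (fun u => (c u).card) hne
    simp only [Finset.mem_filter, Finset.mem_univ, true_and] at hp hmin
    refine ⟨p, fun _ => ⟨hp, fun u hu => ?_⟩⟩
    rcases lam p u with r | r | r
    · exact r
    · have := hmin u hu
      exact (Finset.eq_of_subset_of_card_le r this).ge
    · exact (BinH.notsub r (hH.ne _ (cm v hv)) hp.1 hu.1).elim
  choose par hpar using hpar
  let G : SimpleGraph (Fin n ⊕ Fin (n - 2)) :=
    { Adj := fun u v => (u ≠ Sum.inl z ∧ par u = v) ∨ (v ≠ Sum.inl z ∧ par v = u)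
      symm := ⟨fun u v huv => Or.symm huv⟩
      loopless := ⟨fun u hu => by
        have : u ≠ Sum.inl z ∧ par u = u := by rcases hu with r | r <;> exact r
        have h2 := (hpar u this.1).1
        rw [this.2] at h2
        exact h2.ne rfl⟩ }
  refine ⟨G, c, par, hH, cinj, cr, cl, cm, ?_, fun v hv => (hpar v hv).1, fun v hv => (hpar v hv).2,
    fun u v => Iff.rfl⟩
  intro D hD
  by_cases hDP : D ∈ PP z
  · obtain ⟨i, hi, rfl⟩ := mem_PP.1 hDP
    exact ⟨Sum.inl i, cl i hi⟩
  · refine ⟨Sum.inr (e.symm ⟨D, Finset.mem_sdiff.2 ⟨hD, hDP⟩⟩), ?_⟩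
    simp [c]


theorem exists_par {V : Type} [Fintype V] {G : SimpleGraph V} (hG : G.IsTree) (r : V) :
    ∃ (par : V → V) (d : V → ℕ), (∀ v, v ≠ r → d v = d (par v) + 1) ∧
      (∀ u v, G.Adj u v ↔ (u ≠ r ∧ par u = v) ∨ (v ≠ r ∧ par v = u)) := by
  have h1 : ∀ v, ∃ w, v ≠ r → (G.Adj v w ∧ G.dist v r = G.dist w r + 1) := by
    intro v
    by_cases hv : v = r
    · exact ⟨v, fun hh => absurd hv hh⟩
    obtain ⟨p, hp⟩ := (hG.1 v r).exists_walk_length_eq_dist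
    cases p with
    | nil => exact absurd rfl hv
    | @cons _ w _ hadj q =>
      refine ⟨w, fun _ => ⟨hadj, ?_⟩⟩
      have h2 := SimpleGraph.dist_le q
      obtain ⟨q', hq'⟩ := (hG.1 w r).exists_walk_length_eq_dist
      have h3 := SimpleGraph.dist_le (SimpleGraph.Walk.cons hadj q')
      simp only [SimpleGraph.Walk.length_cons] at hp h3
      omega
  choose par hpar using h1
  refine ⟨par, fun v => G.dist v r, fun v hv => (hpar v hv).2, ?_⟩
  have hinj : Set.InjOn (fun v => s(v, par v)) (Finset.univ.erase r : Finset V) := by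
    intro u hu v hv he
    have hu' : u ≠ r := by simpa using hu
    have hv' : v ≠ r := by simpa using hv
    rcases Sym2.eq_iff.1 he with h | h
    · exact h.1
    · have a := (hpar u hu').2
      have b := (hpar v hv').2
      rw [h.2] at a
      rw [← h.1] at b
      omega
  have himg : (Finset.univ.erase r).image (fun v => s(v, par v)) = G.edgeFinset := by
    apply Finset.eq_of_subset_of_card_le
    · intro e he
      obtain ⟨v, hv, rfl⟩ := Finset.mem_image.1 he
      rw [SimpleGraph.mem_edgeFinset]
      exact (hpar v (Finset.ne_of_mem_erase hv)).1
    · rw [Finset.card_image_of_injOn hinj, Finset.card_erase_of_mem (Finset.mem_univ _),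
        Finset.card_univ]
      have := hG.card_edgeFinset
      omega
  intro u v
  constructor
  · intro h
    have : s(u, v) ∈ (Finset.univ.erase r).image (fun v => s(v, par v)) := by
      rw [himg, SimpleGraph.mem_edgeFinset]; exact h
    obtain ⟨w, hw, he⟩ := Finset.mem_image.1 this
    have hw := Finset.ne_of_mem_erase hw
    rcases Sym2.eq_iff.1 he with h | h
    · left; rw [← h.1]; exact ⟨hw, h.2⟩
    · right; rw [← h.1]; exact ⟨hw, h.2⟩
  · rintro (⟨h, rfl⟩ | ⟨h, rfl⟩)
    · exact (hpar u h).1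
    · exact (hpar v h).1.symm

theorem lab_of_phylo {n : ℕ} {V : Type} [Fintype V] {G : SimpleGraph V} {leaf : Fin n → V}
    (hT : IsBinaryPhylo n G leaf) (z : Fin n) : ∃ c par H, Lab G leaf z c par H := by
  obtain ⟨hG, linj, hdl, hd3⟩ := hT
  obtain ⟨par, d, hd, hadj⟩ := exists_par hG (leaf z)
  let R : V → V → Prop := fun a b => a ≠ leaf z ∧ par a = b
  let A : V → V → Prop := Relation.ReflTransGen R
  have Aref : ∀ v, A v v := fun v => Relation.ReflTransGen.refl
  have Apar : ∀ v, v ≠ leaf z → A v (par v) := fun v hv => Relation.ReflTransGen.single ⟨hv, rfl⟩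
  have Atr : ∀ u v w, A u v → A v w → A u w := fun u v w h1 h2 => h1.trans h2
  have Atot : ∀ w u v, A w u → A w v → A u v ∨ A v u := by
    intro w u v h1 h2
    refine Relation.ReflTransGen.total_of_right_unique ?_ h1 h2
    intro a b b' h h'
    exact h.2.symm.trans h'.2
  have Ahead : ∀ u v, A u v → u ≠ v → u ≠ leaf z ∧ A (par u) v := by
    intro u v h hne
    rcases Relation.ReflTransGen.cases_head h with h | ⟨w, ⟨h1, rfl⟩, h2⟩
    · exact absurd h hne
    · exact ⟨h1, h2⟩
  have Atail : ∀ u v, A u v → u ≠ v → ∃ w, w ≠ leaf z ∧ par w = v ∧ A u w := by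
    intro u v h hne
    rcases Relation.ReflTransGen.cases_tail h with h | ⟨w, h2, ⟨h1, h3⟩⟩
    · exact absurd h.symm hne
    · exact ⟨w, h1, h3, h2⟩
  have Ad : ∀ u v, A u v → u = v ∨ d v < d u := by
    intro u v h
    induction h with
    | refl => exact Or.inl rfl
    | @tail b c' hb hc ih =>
      right
      have := hd b hc.1
      rw [hc.2] at this
      rcases ih with rfl | ih <;> omega
  have Aroot : ∀ v, A v (leaf z) := by
    intro v
    induction hk : d v using Nat.strong_induction_on generalizing v with
    | _ k ih =>
      by_cases hv : v = leaf z
      · subst hv; exact Aref _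
      · have := hd v hv
        exact Atr _ _ _ (Apar v hv) (ih _ (by omega) (par v) rfl)
  let c : V → Finset (Fin n) := fun v => Finset.univ.filter (fun i => A (leaf i) v)
  have mc : ∀ i v, i ∈ c v ↔ A (leaf i) v := fun i v => by simp [c]
  have cmono : ∀ u v, A u v → c u ⊆ c v := by
    intro u v h i hi
    rw [mc] at hi ⊢
    exact Atr _ _ _ hi h
  have cr : c (leaf z) = Finset.univ := by
    ext i; simp only [mc, Finset.mem_univ, iff_true]; exact Aroot _
  have parne : ∀ v, v ≠ leaf z → par v ≠ v := by
    intro v hv hh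
    have := hd v hv
    rw [hh] at this
    omega
  have deg1 : ∀ v a b, G.degree v = 1 → G.Adj v a → G.Adj v b → a = b := by
    intro v a b h1 ha hb
    rw [← SimpleGraph.card_neighborFinset_eq_degree, Finset.card_eq_one] at h1
    obtain ⟨q, hq⟩ := h1
    have ha' : a ∈ G.neighborFinset v := by simpa using ha
    have hb' : b ∈ G.neighborFinset v := by simpa using hb
    rw [hq] at ha' hb'
    rw [Finset.mem_singleton.1 ha', Finset.mem_singleton.1 hb']
  have nochild : ∀ i, i ≠ z → ∀ w, w ≠ leaf z → par w ≠ leaf i := by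
    intro i hi w hw hh
    have hir : leaf i ≠ leaf z := fun h => hi (linj h)
    have h1 : G.Adj (leaf i) w := (hadj _ _).2 (Or.inr ⟨hw, hh⟩)
    have h2 : G.Adj (leaf i) (par (leaf i)) := (hadj _ _).2 (Or.inl ⟨hir, rfl⟩)
    have h3 := deg1 _ _ _ (hdl i) h1 h2
    have h4 := hd w hw
    have h5 := hd _ hir
    rw [hh] at h4
    rw [← h3] at h5
    omega
  have cl : ∀ i, i ≠ z → c (leaf i) = {i} := by
    intro i hi
    ext j
    rw [mc, Finset.mem_singleton]
    constructor
    · intro h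
      by_contra hne
      obtain ⟨w, h1, h2, -⟩ := Atail _ _ h (fun hh => hne (linj hh))
      exact nochild i hi w h1 h2
    · rintro rfl; exact Aref _
  have znot : ∀ v, v ≠ leaf z → z ∉ c v := by
    intro v hv hz
    rw [mc] at hz
    exact (Ahead _ _ hz (Ne.symm hv)).1 rfl
  have kids : ∀ v, v ∉ Set.range leaf → ∃ x y, x ≠ y ∧
      ∀ w, (w ≠ leaf z ∧ par w = v) ↔ w = x ∨ w = y := by
    intro v hv
    have hvr : v ≠ leaf z := fun hh => hv ⟨z, hh.symm⟩
    have h3 := hd3 v hv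
    rw [← SimpleGraph.card_neighborFinset_eq_degree] at h3
    have hp : par v ∈ G.neighborFinset v := by
      rw [SimpleGraph.mem_neighborFinset]; exact (hadj _ _).2 (Or.inl ⟨hvr, rfl⟩)
    have h2 : ((G.neighborFinset v).erase (par v)).card = 2 := by
      rw [Finset.card_erase_of_mem hp, h3]
    obtain ⟨x, y, hxy, he⟩ := Finset.card_eq_two.1 h2
    refine ⟨x, y, hxy, fun w => ?_⟩
    have : w ∈ (G.neighborFinset v).erase (par v) ↔ w = x ∨ w = y := by rw [he]; simp
    rw [← this, Finset.mem_erase, SimpleGraph.mem_neighborFinset, hadj]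
    constructor
    · rintro ⟨h1, h2⟩
      refine ⟨?_, Or.inr ⟨h1, h2⟩⟩
      rintro rfl
      have a := hd v hvr
      have b := hd _ h1
      rw [h2] at b
      omega
    · rintro ⟨h1, h2 | h2⟩
      · exact absurd h2.2.symm h1
      · exact h2
  have cne : ∀ v, (c v).Nonempty := by
    intro v
    have hne : (Finset.univ.filter (fun u => A u v)).Nonempty :=
      ⟨v, by simp only [Finset.mem_filter, Finset.mem_univ, true_and]; exact Aref v⟩
    obtain ⟨u, hu, hmax⟩ := Finset.exists_max_image _ d hne
    simp only [Finset.mem_filter, Finset.mem_univ, true_and] at hu hmax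
    by_cases hur : u ∈ Set.range leaf
    · obtain ⟨i, rfl⟩ := hur
      exact ⟨i, (mc _ _).2 hu⟩
    · obtain ⟨x, y, -, hk⟩ := kids u hur
      have hx := (hk x).2 (Or.inl rfl)
      have h1 := Apar x hx.1
      rw [hx.2] at h1
      have h2 := hmax x (Atr _ _ _ h1 hu)
      have h3 := hd x hx.1
      rw [hx.2] at h3
      omega
  have sib : ∀ x y, x ≠ leaf z → y ≠ leaf z → par x = par y → x ≠ y → Disjoint (c x) (c y) := by
    intro x y hx hy hp hne
    rw [Finset.disjoint_left]
    intro i h1 h2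
    rw [mc] at h1 h2
    have a := hd x hx
    have b := hd y hy
    rw [hp] at a
    rcases Atot _ _ _ h1 h2 with h | h
    · rcases Ad _ _ h with r | r
      · exact hne r
      · omega
    · rcases Ad _ _ h with r | r
      · exact hne r.symm
      · omega
  have plt : ∀ v, v ≠ leaf z → c v ⊂ c (par v) := by
    intro v hv
    refine ⟨cmono _ _ (Apar v hv), fun hh => ?_⟩
    by_cases hp : par v = leaf z
    · rw [hp, cr] at hh
      exact znot v hv (hh (Finset.mem_univ _))
    · have hpr : par v ∉ Set.range leaf := by
        rintro ⟨i, hi⟩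
        have hiz : i ≠ z := by rintro rfl; exact hp hi.symm
        exact nochild i hiz v hv hi.symm
      obtain ⟨x, y, hxy, hk⟩ := kids _ hpr
      have : ∃ w, w ≠ v ∧ w ≠ leaf z ∧ par w = par v := by
        by_cases hvx : v = x
        · exact ⟨y, by rw [hvx]; exact hxy.symm, (hk y).2 (Or.inr rfl)⟩
        · exact ⟨x, Ne.symm hvx, (hk x).2 (Or.inl rfl)⟩
      obtain ⟨w, h1, h2, h3⟩ := this
      have h4 := sib w v h2 hv h3 h1
      have h5 := cmono _ _ (Apar w h2)
      rw [h3] at h5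
      exact BinH.notsub h4 (cne w) subset_rfl (h5.trans hh)
  have strict : ∀ u v, A u v → u ≠ v → c u ⊂ c v := by
    intro u v h hne
    have := Ahead u v h hne
    exact (plt u this.1).trans_subset (cmono _ _ this.2)
  have comp : ∀ u v, c u ⊆ c v → A u v := by
    intro u v h
    obtain ⟨i, hi⟩ := cne u
    have hi' := h hi
    rw [mc] at hi hi'
    rcases Atot _ _ _ hi hi' with r | r
    · exact r
    · by_cases hne : v = u
      · subst hne; exact Aref _
      · exact absurd h (strict _ _ r hne).2
  have cinj : Function.Injective c := by
    intro u v h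
    by_contra hne
    exact (strict u v (comp u v h.le) hne).ne h
  have leafmem : ∀ v, v ≠ leaf z → c v ∉ PP z → v ∉ Set.range leaf := by
    rintro v hv hP ⟨i, rfl⟩
    have hi : i ≠ z := by rintro rfl; exact hv rfl
    exact hP (mem_PP.2 ⟨i, hi, (cl i hi).symm⟩)
  refine ⟨c, par, (Finset.univ.erase (leaf z)).image c, ⟨?_, ?_, ?_, ?_, ?_, ?_⟩, cinj, cr, cl,
    ?_, ?_, plt, ?_, hadj⟩
  · -- top
    obtain ⟨t, ht⟩ : ∃ t, G.Adj (leaf z) t := by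
      have := hdl z
      rw [← SimpleGraph.card_neighborFinset_eq_degree, Finset.card_eq_one] at this
      obtain ⟨t, ht⟩ := this
      refine ⟨t, ?_⟩
      have : t ∈ G.neighborFinset (leaf z) := by rw [ht]; simp
      simpa using this
    have ht' : t ≠ leaf z ∧ par t = leaf z := by
      rcases (hadj _ _).1 ht with h | h
      · exact absurd rfl h.1
      · exact h
    refine Finset.mem_image.2 ⟨t, by simp [ht'.1], ?_⟩
    ext i
    rw [Finset.mem_erase]
    constructor
    · intro hi
      refine ⟨?_, Finset.mem_univ _⟩
      rintro rfl
      exact znot _ ht'.1 hi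
    · rintro ⟨hi, -⟩
      obtain ⟨w, h1, h2, h3⟩ := Atail _ _ (Aroot (leaf i)) (fun h => hi (linj h))
      have : w = t := deg1 _ _ _ (hdl z) ((hadj _ _).2 (Or.inr ⟨h1, h2⟩)) ht
      rw [mc, ← this]
      exact h3
  · intro D hD
    obtain ⟨v, hv, rfl⟩ := Finset.mem_image.1 hD
    intro i hi
    refine Finset.mem_erase.2 ⟨?_, Finset.mem_univ _⟩
    rintro rfl
    exact znot v (Finset.ne_of_mem_erase hv) hi
  · intro D hD
    obtain ⟨v, hv, rfl⟩ := Finset.mem_image.1 hD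
    exact cne v
  · intro D hD
    obtain ⟨i, hi, rfl⟩ := mem_PP.1 hD
    exact Finset.mem_image.2 ⟨leaf i, by simp [linj.ne hi], cl i hi⟩
  · intro p hp D hD hs
    obtain ⟨i, hi, rfl⟩ := mem_PP.1 hp
    obtain ⟨v, hv, rfl⟩ := Finset.mem_image.1 hD
    rcases Finset.subset_singleton_iff.1 hs with h | h
    · exact absurd h (cne v).ne_empty
    · exact h
  · intro D hD hP
    obtain ⟨v, hv, rfl⟩ := Finset.mem_image.1 hD
    have hv := Finset.ne_of_mem_erase hv
    obtain ⟨x, y, hxy, hk⟩ := kids v (leafmem v hv hP)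
    have hx := (hk x).2 (Or.inl rfl)
    have hy := (hk y).2 (Or.inr rfl)
    have key : ∀ w, A w v → w ≠ v → A w x ∨ A w y := by
      intro w hw hne
      obtain ⟨q, h1, h2, h3⟩ := Atail _ _ hw hne
      rcases (hk q).1 ⟨h1, h2⟩ with rfl | rfl
      · exact Or.inl h3
      · exact Or.inr h3
    have sx := cmono _ _ (Apar x hx.1)
    have sy := cmono _ _ (Apar y hy.1)
    rw [hx.2] at sx
    rw [hy.2] at sy
    refine ⟨c x, Finset.mem_image.2 ⟨x, by simp [hx.1], rfl⟩, c y,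
      Finset.mem_image.2 ⟨y, by simp [hy.1], rfl⟩, sib x y hx.1 hy.1 (hx.2.trans hy.2.symm) hxy,
      ?_, ?_⟩
    · apply Finset.Subset.antisymm (Finset.union_subset sx sy)
      intro i hi
      rw [mc] at hi
      rw [Finset.mem_union, mc, mc]
      exact key _ hi (fun hh => leafmem v hv hP ⟨i, hh⟩)
    · intro D' hD' hlt
      obtain ⟨w, hw, rfl⟩ := Finset.mem_image.1 hD'
      have hne : w ≠ v := by rintro rfl; exact hlt.ne rfl
      exact (key w (comp _ _ hlt.1) hne).imp (cmono _ _) (cmono _ _)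
  · intro v hv
    exact Finset.mem_image.2 ⟨v, by simp [hv], rfl⟩
  · intro D hD
    obtain ⟨v, hv, rfl⟩ := Finset.mem_image.1 hD
    exact ⟨v, rfl⟩
  · intro v hv u hlt
    have hne : v ≠ u := by rintro rfl; exact hlt.ne rfl
    exact cmono _ _ (Ahead _ _ (comp _ _ hlt.1) hne).2


theorem choose_alt (k m N : ℕ) (hk : k ≤ N) :
    ∑ s ∈ Finset.Icc m N, (-1 : ℤ) ^ (s - m) * (s.choose m) * (k.choose s) =
      if k = m then 1 else 0 := by
  by_cases hkm : k < m
  · rw [if_neg (by omega)]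
    apply Finset.sum_eq_zero
    intro s hs
    rw [Finset.mem_Icc] at hs
    rw [Nat.choose_eq_zero_of_lt (show k < s by omega)]
    simp
  push Not at hkm
  have h1 : ∑ s ∈ Finset.Icc m N, (-1 : ℤ) ^ (s - m) * (s.choose m) * (k.choose s) =
      ∑ s ∈ Finset.Icc m k, (-1 : ℤ) ^ (s - m) * (s.choose m) * (k.choose s) := by
    symm
    apply Finset.sum_subset (Finset.Icc_subset_Icc_right hk)
    intro s hs hs'
    rw [Finset.mem_Icc] at hs hs'
    rw [Nat.choose_eq_zero_of_lt (show k < s by omega)]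
    simp
  have h2 : ∑ s ∈ Finset.Icc m k, (-1 : ℤ) ^ (s - m) * (s.choose m) * (k.choose s) =
      ∑ j ∈ Finset.range (k - m + 1), (-1 : ℤ) ^ j * ((k - m).choose j) * (k.choose m) := by
    rw [← Finset.Ico_succ_right_eq_Icc, Finset.sum_Ico_eq_sum_range]
    have e : Order.succ k - m = k - m + 1 := by
      rw [Nat.succ_eq_succ]; omega
    rw [e]
    apply Finset.sum_congr rfl
    intro j hj
    rw [Finset.mem_range] at hj
    have := Nat.choose_mul (n := k) (k := m + j) (s := m) (by omega)
    rw [Nat.add_sub_cancel_left] at this ⊢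
    have h' : ((k.choose (m + j) : ℕ) : ℤ) * ((m + j).choose m) = (k.choose m) * ((k - m).choose j) := by
      exact_mod_cast this
    linear_combination (-1 : ℤ) ^ j * h'
  rw [h1, h2, ← Finset.sum_mul, Int.alternating_sum_range_choose]
  by_cases he : k = m
  · subst he; simp
  · rw [if_neg (by omega), if_neg he]; simp

theorem sig_inj {n : ℕ} {z : Fin n} {D D' : Finset (Fin n)} (h : z ∉ D) (h' : z ∉ D')
    (he : Lab.sig D = Lab.sig D') : D = D' := by
  rcases Sym2.eq_iff.1 he with r | r
  · exact r.1
  · exfalso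
    apply h
    rw [r.1]
    simpa using h'

theorem BinH.znot {n : ℕ} {z : Fin n} {H : Finset (Finset (Fin n))} (h : BinH (XX z) (PP z) H)
    {D : Finset (Fin n)} (hD : D ∈ H) : z ∉ D := fun hz => by simpa using h.sub D hD hz

theorem allBPT_eq {n : ℕ} (hn : 3 ≤ n) (z : Fin n) :
    allBPTSplits n = (Finset.univ.filter (fun K => BinH (XX z) (PP z) K)).image
      (fun K => K.image Lab.sig) := by
  ext S
  simp only [allBPTSplits, Finset.mem_filter, Finset.mem_univ, true_and, Finset.mem_image]
  constructor
  · rintro ⟨G, hG, rfl⟩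
    obtain ⟨c, par, H, h⟩ := lab_of_phylo hG z
    exact ⟨H, h.bin, h.splits.symm⟩
  · rintro ⟨K, hK, rfl⟩
    obtain ⟨G, c, par, h⟩ := exists_lab hn z hK
    exact ⟨G, h.phylo, h.splits⟩

theorem trivial_iff {n : ℕ} (hn : 3 ≤ n) {z : Fin n} {D : Finset (Fin n)} (hz : z ∉ D) :
    IsTrivialSplit (Lab.sig D) ↔ D ∈ PP z ∨ D = XX z := by
  have h0 : IsTrivialSplit (Lab.sig D) ↔ D.card = 1 ∨ Dᶜ.card = 1 := by
    unfold IsTrivialSplit Lab.sig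
    constructor
    · rintro ⟨A, hA, h1⟩
      rcases Sym2.mem_iff.1 hA with rfl | rfl
      · exact Or.inl h1
      · exact Or.inr h1
    · rintro (h | h)
      · exact ⟨D, by simp, h⟩
      · exact ⟨Dᶜ, by simp, h⟩
  rw [h0]
  apply or_congr
  · rw [Finset.card_eq_one, mem_PP]
    constructor
    · rintro ⟨i, rfl⟩
      refine ⟨i, ?_, rfl⟩
      rintro rfl
      exact hz (Finset.mem_singleton_self _)
    · rintro ⟨i, -, rfl⟩
      exact ⟨i, rfl⟩
  · rw [Finset.card_eq_one]
    constructor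
    · rintro ⟨i, hi⟩
      have : z ∈ Dᶜ := by simpa using hz
      rw [hi, Finset.mem_singleton] at this
      subst this
      rw [← compl_compl D, hi]
      ext j; simp
    · rintro rfl
      refine ⟨z, ?_⟩
      ext j; simp

theorem q_eq {n : ℕ} (hn : 3 ≤ n) {V : Type} [Fintype V] {G : SimpleGraph V} {leaf : Fin n → V}
    {z : Fin n} {c : V → Finset (Fin n)} {par : V → V} {H : Finset (Finset (Fin n))}
    (h : Lab G leaf z c par H) (m : ℕ) :
    qCoeff n G leaf m = ((Finset.univ.filter (fun K => BinH (XX z) (PP z) K)).filter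
      (fun K => (((H \ PP z).erase (XX z)) ∩ K).card = m)).card := by
  unfold qCoeff
  rw [allBPT_eq hn z, h.splits, Finset.filter_image, Finset.card_image_of_injOn]
  · congr 1
    apply Finset.filter_congr
    intro K hK
    have hK : BinH (XX z) (PP z) K := (Finset.mem_filter.1 hK).2
    have e : ((K.image Lab.sig ∩ H.image Lab.sig).filter (fun σ => ¬ IsTrivialSplit σ)) =
        (((H \ PP z).erase (XX z)) ∩ K).image Lab.sig := by
      ext σ
      simp only [Finset.mem_filter, Finset.mem_inter, Finset.mem_image, Finset.mem_erase,
        Finset.mem_sdiff]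
      constructor
      · rintro ⟨⟨⟨D, hD, rfl⟩, ⟨D', hD', he⟩⟩, ht⟩
        have := sig_inj (h.bin.znot hD') (hK.znot hD) he
        subst this
        rw [trivial_iff hn (hK.znot hD)] at ht
        push Not at ht
        exact ⟨D', ⟨⟨ht.2, hD', ht.1⟩, hD⟩, rfl⟩
      · rintro ⟨D, ⟨⟨h1, h2, h3⟩, h4⟩, rfl⟩
        refine ⟨⟨⟨D, h4, rfl⟩, ⟨D, h2, rfl⟩⟩, ?_⟩
        rw [trivial_iff hn (hK.znot h4)]
        tauto
    rw [e, Finset.card_image_of_injOn]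
    intro D hD D' hD' he
    simp only [Finset.coe_inter, Set.mem_inter_iff, Finset.mem_coe] at hD hD'
    exact sig_inj (hK.znot hD.2) (hK.znot hD'.2) he
  · intro K hK K' hK' he
    simp only [Finset.coe_filter, Finset.mem_filter, Finset.mem_univ, true_and,
      Set.mem_setOf_eq] at hK hK'
    have key : ∀ K K' : Finset (Finset (Fin n)), BinH (XX z) (PP z) K → BinH (XX z) (PP z) K' →
        K.image Lab.sig = K'.image Lab.sig → K ⊆ K' := by
      intro K K' hK hK' he D hD
      have : Lab.sig D ∈ K'.image Lab.sig := by rw [← he]; exact Finset.mem_image_of_mem _ hD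
      obtain ⟨D', hD', he'⟩ := Finset.mem_image.1 this
      rw [← sig_inj (hK'.znot hD') (hK.znot hD) he']
      exact hD'
    exact Finset.Subset.antisymm (key _ _ hK.1 hK'.1 he) (key _ _ hK'.1 hK.1 he.symm)

theorem r_eq {n : ℕ} (hn : 3 ≤ n) {V : Type} [Fintype V] {G : SimpleGraph V} {leaf : Fin n → V}
    {z : Fin n} {c : V → Finset (Fin n)} {par : V → V} {H : Finset (Finset (Fin n))}
    (h : Lab G leaf z c par H) (s : ℕ) :
    rCoeff n G leaf s = ∑ K ∈ Finset.univ.filter (fun K => BinH (XX z) (PP z) K),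
      (((H \ PP z).erase (XX z)) ∩ K).card.choose s := by
  rw [Lab.rC hn h s]
  have e1 : ∀ W : Finset (Finset (Fin n)),
      (Finset.univ.filter (fun K => BinH (XX z) (PP z) K ∧ W ⊆ K)).card =
      ∑ K ∈ Finset.univ.filter (fun K => BinH (XX z) (PP z) K), if W ⊆ K then 1 else 0 := by
    intro W
    rw [← Finset.filter_filter, Finset.card_filter]
  simp_rw [e1]
  rw [Finset.sum_comm]
  apply Finset.sum_congr rfl
  intro K hK
  rw [← Finset.card_filter, ← Finset.card_powersetCard]
  congr 1
  ext W
  simp only [Finset.mem_filter, Finset.mem_powersetCard, Finset.subset_inter_iff]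
  tauto

theorem card_Hint {n : ℕ} (hn : 3 ≤ n) {z : Fin n} {H : Finset (Finset (Fin n))}
    (h : BinH (XX z) (PP z) H) : ((H \ PP z).erase (XX z)).card = n - 3 := by
  have h1 := h.card_int
  rw [card_PP] at h1
  rw [Finset.card_erase_of_mem]
  · omega
  · rw [Finset.mem_sdiff]
    refine ⟨h.top, fun hh => ?_⟩
    obtain ⟨i, hi, he⟩ := mem_PP.1 hh
    have := congrArg Finset.card he
    rw [XX, Finset.card_erase_of_mem (Finset.mem_univ _)] at this
    simp at this
    omega


/-- For `n ≥ 3`, `T ∈ BPT(n)` and `0 ≤ m ≤ n-3`: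
`q_m(T) = ∑_{s=m}^{n-3} (-1)^{s-m} C(s,m) r_s(T)`. -/
theorem qCoeff_eq_alternating_sum {n : ℕ} (hn : 3 ≤ n)
    {V : Type} [Fintype V] (G : SimpleGraph V) (leaf : Fin n → V)
    (hT : IsBinaryPhylo n G leaf) (m : ℕ) (hm : m ≤ n - 3) :
    (qCoeff n G leaf m : ℤ) =
      ∑ s ∈ Finset.Icc m (n - 3),
        (-1 : ℤ) ^ (s - m) * (s.choose m) * (rCoeff n G leaf s) := by
  obtain ⟨c, par, H, h⟩ := lab_of_phylo hT ⟨0, by omega⟩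
  rw [q_eq hn h m]
  simp_rw [r_eq hn h]
  push_cast
  simp_rw [Finset.mul_sum]
  rw [Finset.sum_comm, Finset.card_filter]
  push_cast
  apply Finset.sum_congr rfl
  intro K hK
  rw [choose_alt _ _ _ ((Finset.card_le_card Finset.inter_subset_left).trans
    (card_Hint hn h.bin).le)]
end
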